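/- arXiv:2605.06845 — 2 statements merged into one kernel-verified Lean document; each statement's English description precedes it below -/
import Mathlib

section
/- Suppose Assumption 1 holds and the PDE inversion condition of order β holds for some positive integer β. Then there exist positive constants C and C' such that for all Borel probability measures P, P' on ℝ^d supported in B̄(0,R) and all Σ, Σ' ∈ S, one has ‖p_{P,Σ} − p_{P',Σ'}‖₁ ≥ C' · [ Ψ(‖Σ−Σ'‖_op) + min( W₁(P,P')^β, Ψ( C · W₁(P,P')^β ) ) ]. -/
open MeasureTheory Metric

noncomputable section

abbrev Euc (d : ℕ) : Type := EuclideanSpace ℝ (Fin d)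

noncomputable def opNorm {d : ℕ} (A : Matrix (Fin d) (Fin d) ℝ) : ℝ :=
  ‖LinearMap.toContinuousLinearMap (Matrix.toEuclideanLin A)‖

def quadForm {d : ℕ} (A : Matrix (Fin d) (Fin d) ℝ) (x : Euc d) : ℝ :=
  ∑ i, ∑ j, x i * A i j * x j

def matSet (d : ℕ) (lmin lmax : ℝ) : Set (Matrix (Fin d) (Fin d) ℝ) :=
  {A | A.IsSymm ∧ ∀ v : Euc d, lmin * ‖v‖ ^ 2 ≤ quadForm A v ∧ quadForm A v ≤ lmax * ‖v‖ ^ 2}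

noncomputable def W1 {d : ℕ} (P P' : Measure (Euc d)) : ℝ :=
  sSup {r | ∃ h : Euc d → ℝ, LipschitzWith 1 h ∧ r = (∫ x, h x ∂P) - ∫ x, h x ∂P'}

noncomputable def mixDens {d : ℕ} (f : Euc d → ℝ) (P : Measure (Euc d)) : Euc d → ℝ :=
  fun x => ∫ θ, f (x - θ) ∂P

noncomputable def L1dist {d : ℕ} (p q : Euc d → ℝ) : ℝ :=
  ∫ x, |p x - q x|

/-- Partial derivative in the `i`-th coordinate direction. -/
noncomputable def partialDeriv {d : ℕ} (i : Fin d) (g : Euc d → ℝ) : Euc d → ℝ :=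
  fun x => fderiv ℝ g x (EuclideanSpace.single i 1)

/-- Multi-index partial derivative `∂^ν`. -/
noncomputable def multiDeriv {d : ℕ} (ν : Fin d → ℕ) (g : Euc d → ℝ) : Euc d → ℝ :=
  (List.finRange d).foldr (fun i h => (partialDeriv i)^[ν i] h) g

/-- The finite set of multi-indices `ν ∈ ℕ^d` with `|ν| ≤ β`. -/
def multiIdxSet (d β : ℕ) : Finset (Fin d → ℕ) :=
  (Finset.Iic (fun _ => β)).filter (fun ν => ∑ i, ν i ≤ β)


section Aux

open scoped Convolution ContDiff

/-- smooth and compactly supported -/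
def SC {d : ℕ} (a : Euc d → ℝ) : Prop := ContDiff ℝ ∞ a ∧ HasCompactSupport a

theorem multi_ind {d : ℕ} (Q : (Euc d → ℝ) → (Euc d → ℝ) → ℕ → Prop)
    (hQ : ∀ i n a b, Q a b n → Q (partialDeriv i a) (partialDeriv i b) (n + 1))
    (ν : Fin d → ℕ) (a b : Euc d → ℝ) (h0 : Q a b 0) :
    Q (multiDeriv ν a) (multiDeriv ν b) (∑ i, ν i) := by
  have hit : ∀ i k n a b, Q a b n → Q ((partialDeriv i)^[k] a) ((partialDeriv i)^[k] b) (k + n) := by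
    intro i k
    induction k with
    | zero => intro n a b h; simpa using h
    | succ k ih =>
      intro n a b h
      rw [Function.iterate_succ_apply', Function.iterate_succ_apply']
      have := hQ i _ _ _ (ih n a b h)
      rwa [show k + 1 + n = k + n + 1 by ring]
  rw [Fin.sum_univ_def]
  unfold multiDeriv
  generalize List.finRange d = l
  induction l with
  | nil => simpa using h0
  | cons i l ih =>
    simp only [List.foldr_cons, List.map_cons, List.sum_cons]
    exact hit _ _ _ _ _ ih

theorem SC.partialDeriv {d : ℕ} {a : Euc d → ℝ} (h : SC a) (i : Fin d) : SC (partialDeriv i a) := by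
  refine ⟨?_, ?_⟩
  · have := h.1.fderiv_right (m := ∞) (by simp)
    exact this.clm_apply contDiff_const
  · exact h.2.fderiv_apply ℝ _

theorem SC.multiDeriv {d : ℕ} {a : Euc d → ℝ} (h : SC a) (ν : Fin d → ℕ) : SC (multiDeriv ν a) :=
  multi_ind (fun a _ _ => SC a) (fun i _ _ _ h => h.partialDeriv i) ν a a h

theorem SC.continuous {d : ℕ} {a : Euc d → ℝ} (h : SC a) : Continuous a := h.1.continuous

theorem SC.integrable {d : ℕ} {a : Euc d → ℝ} (h : SC a) : Integrable a :=
  h.continuous.integrable_of_hasCompactSupport h.2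

theorem SC.integral_partialDeriv {d : ℕ} {a : Euc d → ℝ} (h : SC a) (i : Fin d) :
    ∫ x, _root_.partialDeriv i a x = 0 := by
  have := integral_mul_fderiv_eq_neg_fderiv_mul_of_integrable (μ := volume) (𝕜 := ℝ)
    (f := fun _ : Euc d => (1 : ℝ)) (g := a) (v := EuclideanSpace.single i 1)
    (by simp) (by simp only [one_mul]; exact (h.partialDeriv i).integrable) (by simpa using h.integrable)
    (by simp) (fun x _ => (h.1.differentiable (by simp)) x)
  simpa [_root_.partialDeriv] using this

theorem SC.integral_multiDeriv {d : ℕ} {a : Euc d → ℝ} (h : SC a) (ν : Fin d → ℕ)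
    (hν : ∑ i, ν i ≠ 0) : ∫ x, _root_.multiDeriv ν a x = 0 :=
  (multi_ind (fun a _ n => SC a ∧ (n ≠ 0 → ∫ x, a x = 0))
    (fun i _ _ _ h => ⟨h.1.partialDeriv i, fun _ => h.1.integral_partialDeriv i⟩) ν a a
    ⟨h, fun h => absurd rfl h⟩).2 hν

/-- convolution -/
def cv {d : ℕ} (u a : Euc d → ℝ) : Euc d → ℝ :=
  u ⋆[ContinuousLinearMap.lsmul ℝ ℝ, volume] a

theorem cv_apply {d : ℕ} (u a : Euc d → ℝ) (x : Euc d) : cv u a x = ∫ t, u (x - t) * a t := by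
  simp [cv, convolution_lsmul_swap]

theorem cv_partial {d : ℕ} {u a : Euc d → ℝ} (hu : Continuous u) (ha : SC a) (i : Fin d) :
    partialDeriv i (cv u a) = cv u (partialDeriv i a) := by
  ext x
  have := ha.2.hasFDerivAt_convolution_right (ContinuousLinearMap.lsmul ℝ ℝ)
    (μ := volume) (f := u) hu.locallyIntegrable (ha.1.of_le (by simp)) x
  unfold partialDeriv cv
  rw [this.fderiv, convolution_precompR_apply _ hu.locallyIntegrable (ha.2.fderiv ℝ)
    (ha.1.continuous_fderiv (by simp))]

theorem cv_multi {d : ℕ} {u a : Euc d → ℝ} (hu : Continuous u) (ha : SC a) (ν : Fin d → ℕ) :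
    multiDeriv ν (cv u a) = cv u (multiDeriv ν a) :=
  (multi_ind (fun a b _ => SC a ∧ b = cv u a)
    (fun i _ a b h => ⟨h.1.partialDeriv i, by rw [h.2, cv_partial hu h.1]⟩) ν a (cv u a)
    ⟨ha, rfl⟩).2

theorem cv_sc {d : ℕ} {u a : Euc d → ℝ} (hu : Continuous u) (hu' : HasCompactSupport u)
    (ha : SC a) : SC (cv u a) :=
  ⟨ha.2.contDiff_convolution_right (n := (⊤ : ℕ∞)) _ hu.locallyIntegrable ha.1,
    HasCompactSupport.convolution _ hu' ha.2⟩

theorem cv_bound {d : ℕ} {u a : Euc d → ℝ} (hu : LipschitzWith 1 u) (ha : SC a) (x : Euc d) :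
    |cv u a x - u x * ∫ t, a t| ≤ ∫ t, ‖t‖ * |a t| := by
  have i1 : Integrable (fun t => u (x - t) * a t) :=
    ((hu.continuous.comp (continuous_const.sub continuous_id)).mul
      ha.continuous).integrable_of_hasCompactSupport ha.2.mul_left
  have i2 : Integrable (fun t => ‖t‖ * |a t|) :=
    (continuous_norm.mul ha.continuous.abs).integrable_of_hasCompactSupport
      (HasCompactSupport.mul_left ha.2.norm)
  rw [cv_apply, ← integral_const_mul, ← integral_sub i1 (ha.integrable.const_mul _)]
  rw [← Real.norm_eq_abs]
  refine norm_integral_le_of_norm_le i2 (Filter.Eventually.of_forall fun t => ?_)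
  rw [← sub_mul, norm_mul, Real.norm_eq_abs (a t)]
  gcongr
  have := hu.dist_le_mul (x - t) x
  simpa [Real.dist_eq, dist_eq_norm] using this

theorem scale_multi {d : ℕ} {a : Euc d → ℝ} (ha : SC a) (ε : ℝ) (ν : Fin d → ℕ) :
    multiDeriv ν (fun x => ε * a (ε⁻¹ • x)) =
      fun x => ε * (ε⁻¹ ^ (∑ i, ν i) * multiDeriv ν a (ε⁻¹ • x)) := by
  refine (multi_ind (fun a b n => SC a ∧ b = fun x => ε * (ε⁻¹ ^ n * a (ε⁻¹ • x)))
    (fun i n a b h => ⟨h.1.partialDeriv i, ?_⟩) ν a (fun x => ε * a (ε⁻¹ • x))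
    ⟨ha, by simp⟩).2
  rw [h.2]
  ext x
  have hd : DifferentiableAt ℝ (fun x => a (ε⁻¹ • x)) x :=
    ((h.1.1.differentiable (by simp)).comp (differentiable_id.const_smul ε⁻¹)) x
  unfold partialDeriv
  simp_rw [← mul_assoc]
  rw [fderiv_const_mul hd, fderiv_comp_smul]
  simp
  ring

theorem exists_rho (d : ℕ) : ∃ ρ : Euc d → ℝ, SC ρ ∧ ∫ x, ρ x = 1 := by
  let b : ContDiffBump (0 : Euc d) := ⟨1, 2, by norm_num, by norm_num⟩
  exact ⟨b.normed volume, ⟨b.contDiff_normed (n := ⊤), b.hasCompactSupport_normed⟩, b.integral_normed⟩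

/-- The key approximation lemma. -/
theorem exists_approx (d β : ℕ) (hβ : 0 < β) (R E : ℝ) (hR : 0 < R) (hE : 0 < E) :
    ∃ K : ℝ, 0 < K ∧ ∀ g : Euc d → ℝ, LipschitzWith 1 g → HasCompactSupport g →
      (∀ x, |g x| ≤ R) → ∀ ε, 0 < ε → ε ≤ E → ∃ φ : Euc d → ℝ, SC φ ∧
        (∀ x, |φ x - g x| ≤ K * ε) ∧
        ∀ ν ∈ multiIdxSet d β, ∀ x, ε ^ β * |multiDeriv ν φ x| ≤ K * ε := by
  obtain ⟨ρ, hρ, hρ1⟩ := exists_rho d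
  set k : (Fin d → ℕ) → ℝ := fun ν => ∫ t, ‖t‖ * |multiDeriv ν ρ t| with hk
  set k0 : ℝ := ∫ t, ‖t‖ * |ρ t| with hk0
  have hk_nn : ∀ ν, 0 ≤ k ν := fun ν => integral_nonneg fun t => by positivity
  have hk0_nn : 0 ≤ k0 := integral_nonneg fun t => by positivity
  set M := max 1 E with hM
  have hM1 : 1 ≤ M := le_max_left _ _
  have hME : E ≤ M := le_max_right _ _
  have hsum : 0 ≤ ∑ ν ∈ multiIdxSet d β, k ν := Finset.sum_nonneg fun ν _ => hk_nn ν
  refine ⟨M ^ β * (∑ ν ∈ multiIdxSet d β, k ν + k0 + R + k0 * E + 1), by positivity, ?_⟩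
  intro g hg hgc hgR ε hε hεE
  have hMβ : 1 ≤ M ^ β := one_le_pow₀ hM1
  set u : Euc d → ℝ := fun x => ε⁻¹ * g (ε • x) with hu
  have huL : LipschitzWith 1 u := by
    refine LipschitzWith.of_dist_le_mul fun x y => ?_
    have h1 := hg.dist_le_mul (ε • x) (ε • y)
    rw [Real.dist_eq] at h1 ⊢
    rw [dist_smul₀, Real.norm_of_nonneg hε.le] at h1
    simp only [hu, ← mul_sub, abs_mul, abs_of_pos (inv_pos.2 hε)]
    simp only [NNReal.coe_one, one_mul] at h1 ⊢
    rw [inv_mul_le_iff₀ hε]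
    exact h1
  have huc : HasCompactSupport u := (hgc.comp_smul hε.ne').mul_left
  set G := cv u ρ with hG
  have hGs : SC G := cv_sc huL.continuous huc hρ
  have happ : ∀ x, |ε * G (ε⁻¹ • x) - g x| ≤ k0 * ε := by
    intro x
    have h1 := cv_bound huL hρ (ε⁻¹ • x)
    rw [hρ1, mul_one] at h1
    have h2 : g x = ε * u (ε⁻¹ • x) := by
      simp [hu, smul_smul, hε.ne']
    rw [h2, ← mul_sub, abs_mul, abs_of_pos hε, mul_comm]
    exact mul_le_mul_of_nonneg_right h1 hε.le
  refine ⟨fun x => ε * G (ε⁻¹ • x), ⟨?_, ?_⟩, ?_, ?_⟩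
  · exact contDiff_const.mul (hGs.1.comp (contDiff_id.const_smul ε⁻¹))
  · exact (hGs.2.comp_smul (inv_ne_zero hε.ne')).mul_left
  · intro x
    refine (happ x).trans ?_
    gcongr
    calc k0 ≤ 1 * (∑ ν ∈ multiIdxSet d β, k ν + k0 + R + k0 * E + 1) := by
          have : 0 ≤ k0 * E := by positivity
          linarith
      _ ≤ _ := by gcongr
  · intro ν hν x
    have hνβ : ∑ i, ν i ≤ β := (Finset.mem_filter.1 hν).2
    have hεM : ∀ n ≤ β, ε ^ n ≤ M ^ β := fun n hn =>
      (pow_le_pow_left₀ hε.le (hεE.trans hME) n).trans (pow_le_pow_right₀ hM1 hn)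
    by_cases h0 : ∑ i, ν i = 0
    · have hν0 : ν = 0 := by
        ext i
        exact (Finset.sum_eq_zero_iff.1 h0) i (Finset.mem_univ _)
      have hmd : multiDeriv ν (fun x => ε * G (ε⁻¹ • x)) x = ε * G (ε⁻¹ • x) := by
        rw [scale_multi hGs, h0]
        have : multiDeriv ν G = G := by
          subst hν0
          unfold multiDeriv
          generalize List.finRange d = l
          induction l with
          | nil => rfl
          | cons i l ih => simp
        rw [this]; simp
      rw [hmd]
      have h3 : |ε * G (ε⁻¹ • x)| ≤ R + k0 * E := by
        have h4 := happ x
        have h5 := hgR x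
        have h6 : k0 * ε ≤ k0 * E := by gcongr
        rw [abs_le] at *
        constructor <;> linarith [h4.1, h4.2, h5.1, h5.2]
      have h7 : ε ^ β = ε ^ (β - 1) * ε := by
        rw [← pow_succ, Nat.sub_add_cancel hβ]
      rw [h7]
      calc ε ^ (β - 1) * ε * |ε * G (ε⁻¹ • x)| = ε ^ (β - 1) * |ε * G (ε⁻¹ • x)| * ε := by ring
        _ ≤ M ^ β * (∑ ν ∈ multiIdxSet d β, k ν + k0 + R + k0 * E + 1) * ε := by
          gcongr
          · exact hεM _ (by omega)
          · linarith
    · rw [scale_multi hGs, cv_multi huL.continuous hρ]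
      have h1 := cv_bound huL (hρ.multiDeriv ν) (ε⁻¹ • x)
      rw [hρ.integral_multiDeriv ν h0, mul_zero, sub_zero] at h1
      simp only [abs_mul, abs_of_pos hε, abs_pow, abs_of_pos (inv_pos.2 hε)]
      have h7 : ε ^ β = ε ^ (β - ∑ i, ν i) * ε ^ (∑ i, ν i) := by
        rw [← pow_add, Nat.sub_add_cancel hνβ]
      have h8 : ε ^ (∑ i, ν i) * ε⁻¹ ^ (∑ i, ν i) = 1 := by
        rw [← mul_pow, mul_inv_cancel₀ hε.ne', one_pow]
      calc ε ^ β * (ε * (ε⁻¹ ^ (∑ i, ν i) * |cv u (multiDeriv ν ρ) (ε⁻¹ • x)|))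
          = ε ^ (β - ∑ i, ν i) * |cv u (multiDeriv ν ρ) (ε⁻¹ • x)| * ε *
            (ε ^ (∑ i, ν i) * ε⁻¹ ^ (∑ i, ν i)) := by rw [h7]; ring
        _ = ε ^ (β - ∑ i, ν i) * |cv u (multiDeriv ν ρ) (ε⁻¹ • x)| * ε := by rw [h8, mul_one]
        _ ≤ M ^ β * (∑ ν ∈ multiIdxSet d β, k ν + k0 + R + k0 * E + 1) * ε := by
          gcongr
          · exact hεM _ (by omega)
          · have h9 : k ν ≤ ∑ ν ∈ multiIdxSet d β, k ν :=
              Finset.single_le_sum (fun ν _ => hk_nn ν) hν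
            have : 0 ≤ k0 * E := by positivity
            have : |cv u (multiDeriv ν ρ) (ε⁻¹ • x)| ≤ k ν := h1
            linarith

end Aux

section Aux2

open scoped ContDiff

theorem mix_props {d : ℕ} {f : Euc d → ℝ} (hm : Measurable f) (hn : ∀ x, 0 ≤ f x)
    (hi : ∫ x, f x = 1) (P : Measure (Euc d)) [IsProbabilityMeasure P] :
    Integrable (mixDens f P) ∧ (∀ x, 0 ≤ mixDens f P x) ∧ ∫ x, mixDens f P x = 1 := by
  have hfi : Integrable f := integrable_of_integral_eq_one hi
  have hprod : Integrable (fun z : Euc d × Euc d => f (z.1 - z.2)) (volume.prod P) := by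
    have hms : AEStronglyMeasurable (fun z : Euc d × Euc d => f (z.1 - z.2)) (volume.prod P) :=
      (hm.comp (measurable_fst.sub measurable_snd)).aestronglyMeasurable
    rw [integrable_prod_iff' hms]
    refine ⟨Filter.Eventually.of_forall fun θ => hfi.comp_sub_right θ, ?_⟩
    have : ∀ θ : Euc d, ∫ x, ‖f (x - θ)‖ = 1 := by
      intro θ
      rw [integral_sub_right_eq_self (fun x => ‖f x‖) θ, ← hi]
      exact integral_congr_ae (Filter.Eventually.of_forall fun x => Real.norm_of_nonneg (hn x))
    simp only [this]
    exact integrable_const _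
  refine ⟨hprod.integral_prod_left, fun x => integral_nonneg fun θ => hn _, ?_⟩
  unfold mixDens
  rw [integral_integral_swap hprod]
  have : ∀ θ : Euc d, ∫ x, f (x - θ) = 1 := fun θ => by
    rw [integral_sub_right_eq_self f θ, hi]
  simp [this]

theorem ae_ball {d : ℕ} {R : ℝ} {P : Measure (Euc d)} (hP : P (closedBall 0 R)ᶜ = 0) :
    ∀ᵐ x ∂P, ‖x‖ ≤ R := by
  have : ∀ᵐ x ∂P, x ∈ closedBall (0 : Euc d) R := by
    rw [ae_iff]; exact hP
  filter_upwards [this] with x hx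
  simpa using hx

theorem lip_bound {d : ℕ} {h : Euc d → ℝ} (hh : LipschitzWith 1 h) (h0 : h 0 = 0) (x : Euc d) :
    |h x| ≤ ‖x‖ := by
  have := hh.dist_le_mul x 0
  simpa [Real.dist_eq, h0] using this

theorem cont_int {d : ℕ} {R B : ℝ} {P : Measure (Euc d)} [IsProbabilityMeasure P]
    (hP : P (closedBall 0 R)ᶜ = 0) {h : Euc d → ℝ} (hh : Continuous h)
    (hb : ∀ x, ‖x‖ ≤ R → |h x| ≤ B) : Integrable h P ∧ |∫ x, h x ∂P| ≤ B := by
  have hae : ∀ᵐ x ∂P, ‖h x‖ ≤ B := by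
    filter_upwards [ae_ball hP] with x hx using hb x hx
  refine ⟨Integrable.of_bound hh.aestronglyMeasurable B hae, ?_⟩
  have := norm_integral_le_of_norm_le_const hae
  simpa using this

theorem shift {d : ℕ} {R : ℝ} {P P' : Measure (Euc d)} [IsProbabilityMeasure P]
    [IsProbabilityMeasure P'] (hP : P (closedBall 0 R)ᶜ = 0) (hP' : P' (closedBall 0 R)ᶜ = 0)
    {h : Euc d → ℝ} (hh : LipschitzWith 1 h) :
    ∃ k : Euc d → ℝ, LipschitzWith 1 k ∧ k 0 = 0 ∧
      (∫ x, h x ∂P) - ∫ x, h x ∂P' = (∫ x, k x ∂P) - ∫ x, k x ∂P' := by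
  have hk : LipschitzWith 1 (fun x => h x - h 0) := by
    refine LipschitzWith.of_dist_le_mul fun x y => ?_
    simpa using hh.dist_le_mul x y
  refine ⟨fun x => h x - h 0, hk, by simp, ?_⟩
  have hb : ∀ x : Euc d, ‖x‖ ≤ R → |h x - h 0| ≤ R :=
    fun x hx => (lip_bound hk (by simp) x).trans hx
  have i1 := (cont_int hP hk.continuous hb).1
  have i2 := (cont_int hP' hk.continuous hb).1
  have e1 : ∫ x, h x ∂P = (∫ x, (h x - h 0) ∂P) + h 0 := by
    have : ∫ x, h x ∂P = ∫ x, ((h x - h 0) + h 0) ∂P := by simp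
    rw [this, integral_add i1 (integrable_const _)]; simp
  have e2 : ∫ x, h x ∂P' = (∫ x, (h x - h 0) ∂P') + h 0 := by
    have : ∫ x, h x ∂P' = ∫ x, ((h x - h 0) + h 0) ∂P' := by simp
    rw [this, integral_add i2 (integrable_const _)]; simp
  rw [e1, e2]; ring

theorem W1_le {d : ℕ} {R X : ℝ} {P P' : Measure (Euc d)} [IsProbabilityMeasure P]
    [IsProbabilityMeasure P'] (hP : P (closedBall 0 R)ᶜ = 0) (hP' : P' (closedBall 0 R)ᶜ = 0)
    (hX : ∀ h : Euc d → ℝ, LipschitzWith 1 h → h 0 = 0 →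
      (∫ x, h x ∂P) - ∫ x, h x ∂P' ≤ X) : W1 P P' ≤ X := by
  refine csSup_le ⟨0, fun _ => 0, LipschitzWith.const' 0, by simp⟩ ?_
  rintro r ⟨h, hh, rfl⟩
  obtain ⟨k, hk, hk0, e⟩ := shift hP hP' hh
  rw [e]; exact hX k hk hk0

theorem diff_le {d : ℕ} {R : ℝ} {P P' : Measure (Euc d)} [IsProbabilityMeasure P]
    [IsProbabilityMeasure P'] (hP : P (closedBall 0 R)ᶜ = 0) (hP' : P' (closedBall 0 R)ᶜ = 0)
    (h : Euc d → ℝ) (hh : LipschitzWith 1 h) (h0 : h 0 = 0) :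
    (∫ x, h x ∂P) - ∫ x, h x ∂P' ≤ 2 * R := by
  have hb : ∀ x : Euc d, ‖x‖ ≤ R → |h x| ≤ R := fun x hx => (lip_bound hh h0 x).trans hx
  have a1 := (abs_le.1 (cont_int hP hh.continuous hb).2).2
  have a2 := (abs_le.1 (cont_int hP' hh.continuous hb).2).1
  linarith

theorem W1_nonneg {d : ℕ} {R : ℝ} {P P' : Measure (Euc d)} [IsProbabilityMeasure P]
    [IsProbabilityMeasure P'] (hP : P (closedBall 0 R)ᶜ = 0) (hP' : P' (closedBall 0 R)ᶜ = 0) :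
    0 ≤ W1 P P' := by
  refine le_csSup ⟨2 * R, ?_⟩ ⟨fun _ => 0, LipschitzWith.const' 0, by simp⟩
  rintro r ⟨h, hh, rfl⟩
  obtain ⟨k, hk, hk0, e⟩ := shift hP hP' hh
  rw [e]; exact diff_le hP hP' k hk hk0

theorem trunc {d : ℕ} {R : ℝ} (hR : 0 < R) {h : Euc d → ℝ} (hh : LipschitzWith 1 h)
    (h0 : h 0 = 0) : ∃ g : Euc d → ℝ, LipschitzWith 1 g ∧ HasCompactSupport g ∧
      (∀ x, |g x| ≤ 2 * R) ∧ ∀ x, ‖x‖ ≤ R → g x = h x := by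
  have hm : LipschitzWith 1 (fun x : Euc d => max (2 * R - ‖x‖) 0) := by
    have h1 : LipschitzWith 1 (fun x : Euc d => 2 * R - ‖x‖) := by
      refine LipschitzWith.of_dist_le_mul fun x y => ?_
      rw [Real.dist_eq, dist_eq_norm]
      have := abs_norm_sub_norm_le y x
      rw [norm_sub_rev] at this
      simpa using this
    exact h1.max_const 0
  set m := fun x : Euc d => max (2 * R - ‖x‖) 0 with hmd
  have hm0 : ∀ x, 0 ≤ m x := fun x => le_max_right _ _
  have hb : ∀ x, |max (min (h x) (m x)) (-(m x))| ≤ m x := by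
    intro x
    rw [abs_le]
    exact ⟨le_max_right _ _, max_le (min_le_right _ _) (by linarith [hm0 x])⟩
  refine ⟨fun x => max (min (h x) (m x)) (-(m x)), ?_, ?_, ?_, ?_⟩
  · simpa only [max_self, Pi.neg_apply] using (hh.min hm).max hm.neg
  · refine HasCompactSupport.of_support_subset_isCompact (isCompact_closedBall (0 : Euc d) (2 * R)) ?_
    intro x hx
    by_contra hx'
    have : m x = 0 := by
      simp only [mem_closedBall, dist_zero_right, not_le] at hx'
      exact max_eq_right (by linarith)
    apply hx
    have h2 := hb x
    exact abs_nonpos_iff.1 (h2.trans this.le)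
  · intro x
    exact (hb x).trans (max_le (by linarith [norm_nonneg x]) (by linarith))
  · intro x hx
    have h1 := abs_le.1 (lip_bound hh h0 x)
    have h2 : R ≤ m x := le_max_of_le_left (by linarith)
    simp only
    rw [min_eq_left (by linarith), max_eq_left (by linarith)]

theorem core {d β : ℕ} {p q : Euc d → ℝ} (hp : Integrable p) (hq : Integrable q)
    (hq0 : ∀ x, 0 ≤ q x) (hq1 : ∫ x, q x = 1) {φ : Euc d → ℝ} (hφ : SC φ)
    {cA cB : (Fin d → ℕ) → ℝ} {M B δ : ℝ} (hA : ∀ ν ∈ multiIdxSet d β, |cA ν| ≤ M)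
    (hδ : ∀ ν ∈ multiIdxSet d β, |cA ν - cB ν| ≤ δ)
    (hB : ∀ ν ∈ multiIdxSet d β, ∀ x, |multiDeriv ν φ x| ≤ B) :
    (∫ x, p x * ∑ ν ∈ multiIdxSet d β, (-1 : ℝ) ^ (∑ i, ν i) * cA ν * multiDeriv ν φ x) -
    (∫ x, q x * ∑ ν ∈ multiIdxSet d β, (-1 : ℝ) ^ (∑ i, ν i) * cB ν * multiDeriv ν φ x) ≤
      (multiIdxSet d β).card * ((M * B) * L1dist p q + δ * B) := by
  have bd : ∀ (e : (Fin d → ℕ) → ℝ) (s : ℝ), (∀ ν ∈ multiIdxSet d β, |e ν| ≤ s) → ∀ x,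
      |∑ ν ∈ multiIdxSet d β, (-1 : ℝ) ^ (∑ i, ν i) * e ν * multiDeriv ν φ x| ≤
        (multiIdxSet d β).card * (s * B) := by
    intro e s hs x
    refine (Finset.abs_sum_le_sum_abs _ _).trans ?_
    rw [← nsmul_eq_mul]
    refine Finset.sum_le_card_nsmul _ _ _ fun ν hν => ?_
    rw [abs_mul, abs_mul, abs_pow, abs_neg, abs_one, one_pow, one_mul]
    exact mul_le_mul (hs ν hν) (hB ν hν x) (abs_nonneg _) ((abs_nonneg _).trans (hs ν hν))
  have ct : ∀ (e : (Fin d → ℕ) → ℝ), Continuous fun x =>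
      ∑ ν ∈ multiIdxSet d β, (-1 : ℝ) ^ (∑ i, ν i) * e ν * multiDeriv ν φ x := fun e =>
    continuous_finsetSum _ fun ν _ => continuous_const.mul (hφ.multiDeriv ν).continuous
  have hit : ∀ (r : Euc d → ℝ), Integrable r → ∀ (e : (Fin d → ℕ) → ℝ) (s : ℝ),
      (∀ ν ∈ multiIdxSet d β, |e ν| ≤ s) → Integrable fun x => r x *
        ∑ ν ∈ multiIdxSet d β, (-1 : ℝ) ^ (∑ i, ν i) * e ν * multiDeriv ν φ x := by
    intro r hr e s hs
    exact hr.mul_bdd (ct e).aestronglyMeasurable (Filter.Eventually.of_forall (bd e s hs))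
  set TA := fun x => ∑ ν ∈ multiIdxSet d β, (-1 : ℝ) ^ (∑ i, ν i) * cA ν * multiDeriv ν φ x with hTA
  set TB := fun x => ∑ ν ∈ multiIdxSet d β, (-1 : ℝ) ^ (∑ i, ν i) * cB ν * multiDeriv ν φ x with hTB
  set TD := fun x => ∑ ν ∈ multiIdxSet d β,
    (-1 : ℝ) ^ (∑ i, ν i) * (cA ν - cB ν) * multiDeriv ν φ x with hTD
  have hAB : ∀ x, TD x = TA x - TB x := by
    intro x
    simp only [hTA, hTB, hTD, ← Finset.sum_sub_distrib]
    exact Finset.sum_congr rfl fun ν _ => by ring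
  have hB' : ∀ ν ∈ multiIdxSet d β, |cB ν| ≤ M + δ := by
    intro ν hν
    have h1 := abs_le.1 (hA ν hν)
    have h2 := abs_le.1 (hδ ν hν)
    rw [abs_le]; constructor <;> linarith [h1.1, h1.2, h2.1, h2.2]
  have e : (∫ x, p x * TA x) - (∫ x, q x * TB x) =
      (∫ x, (p x - q x) * TA x) + ∫ x, q x * TD x := by
    have i1 : Integrable fun x => (p x - q x) * TA x := hit _ (hp.sub hq) cA M hA
    have i2 : Integrable fun x => q x * TD x := hit q hq _ δ hδ
    have i3 : Integrable fun x => p x * TA x := hit p hp cA M hA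
    have i4 : Integrable fun x => q x * TB x := hit q hq cB _ hB'
    rw [← integral_sub i3 i4, ← integral_add i1 i2]
    refine integral_congr_ae (Filter.Eventually.of_forall fun x => ?_)
    simp only [hAB x]
    ring
  have b1 : ∫ x, (p x - q x) * TA x ≤ (multiIdxSet d β).card * (M * B) * L1dist p q := by
    unfold L1dist
    rw [← integral_const_mul]
    refine integral_mono (hit _ (hp.sub hq) cA M hA) ((hp.sub hq).abs.const_mul _) fun x => ?_
    have := bd cA M hA x
    calc (p x - q x) * TA x ≤ |(p x - q x) * TA x| := le_abs_self _
      _ = |TA x| * |p x - q x| := by rw [abs_mul, mul_comm]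
      _ ≤ _ := by gcongr
  have b2 : ∫ x, q x * TD x ≤ (multiIdxSet d β).card * (δ * B) := by
    have : ∫ x, q x * TD x ≤ ∫ x, q x * ((multiIdxSet d β).card * (δ * B)) := by
      refine integral_mono (hit q hq _ δ hδ) (hq.mul_const _) fun x => ?_
      exact mul_le_mul_of_nonneg_left ((le_abs_self _).trans (bd _ δ hδ x)) (hq0 x)
    rwa [integral_mul_const, hq1, one_mul] at this
  rw [e]
  linarith

theorem arith_key {β : ℕ} {K N Mc L D a ε W : ℝ} (hK : 0 < K) (hN0 : 0 ≤ N) (hMc0 : 0 ≤ Mc)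
    (hL : 0 < L) (hD0 : 0 ≤ D) (ha0 : 0 ≤ a) (hε0 : 0 < ε) (hεW : W = 4 * (K + 1) * ε)
    (hWle : W ≤ 2 * (K * ε) + N * ((Mc * (K * ε / ε ^ β)) * D + (L * a) * (K * ε / ε ^ β))) :
    W ^ β ≤ ((4 * (K + 1)) ^ β * (N * (Mc + L)) + 1) * (D + a) := by
  have h1 : 2 * (K + 1) * ε ≤ N * (Mc * D + L * a) * (K * ε / ε ^ β) := by
    have : 2 * (K * ε) ≤ 2 * (K + 1) * ε := by nlinarith
    nlinarith
  have h2 : ε ^ β ≤ N * (Mc * D + L * a) := by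
    have h3 : 2 * (K + 1) * ε * ε ^ β ≤ N * (Mc * D + L * a) * (K * ε) := by
      calc 2 * (K + 1) * ε * ε ^ β ≤ N * (Mc * D + L * a) * (K * ε / ε ^ β) * ε ^ β := by gcongr
        _ = _ := by field_simp
    have h4 : N * (Mc * D + L * a) * (K * ε) ≤ N * (Mc * D + L * a) * (2 * (K + 1) * ε) := by
      refine mul_le_mul_of_nonneg_left ?_ (by positivity)
      nlinarith
    have h5 : (2 * (K + 1) * ε) * ε ^ β ≤ (2 * (K + 1) * ε) * (N * (Mc * D + L * a)) := by linarith
    exact le_of_mul_le_mul_left h5 (by positivity)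
  have h6 : Mc * D + L * a ≤ (Mc + L) * (D + a) := by
    have : 0 ≤ Mc * a := by positivity
    have : 0 ≤ L * D := by positivity
    linarith
  calc W ^ β = (4 * (K + 1)) ^ β * ε ^ β := by rw [← mul_pow, ← hεW]
    _ ≤ (4 * (K + 1)) ^ β * (N * ((Mc + L) * (D + a))) := by
      gcongr
      exact h2.trans (mul_le_mul_of_nonneg_left h6 hN0)
    _ = ((4 * (K + 1)) ^ β * (N * (Mc + L))) * (D + a) := by ring
    _ ≤ ((4 * (K + 1)) ^ β * (N * (Mc + L)) + 1) * (D + a) := by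
      gcongr
      linarith

theorem arith_final {C₀ Q D w a : ℝ} {Ψ : ℝ → ℝ} (hC₀ : 0 < C₀) (hQ0 : 0 < Q)
    (hΨmono : StrictMonoOn Ψ (Set.Ici 0)) (hD0 : 0 ≤ D) (hw : 0 ≤ w) (ha : 0 ≤ a)
    (hkey : w ≤ Q * (D + a)) (h1 : C₀ * Ψ a ≤ D) :
    1 / (2 * Q + 2 / C₀) * (Ψ a + min w (Ψ (1 / (2 * Q) * w))) ≤ D := by
  have hC'pos : 0 < 2 * Q + 2 / C₀ := by positivity
  have h2 : Ψ a ≤ D / C₀ := by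
    rw [le_div_iff₀ hC₀]; linarith
  have h3 : min w (Ψ (1 / (2 * Q) * w)) ≤ 2 * Q * D + D / C₀ := by
    have e1 : 0 ≤ D / C₀ := by positivity
    have e2 : 0 ≤ 2 * Q * D := by positivity
    rcases le_total a D with hle | hle
    · refine (min_le_left _ _).trans ?_
      have : Q * (D + a) ≤ Q * (D + D) := by gcongr
      linarith
    · refine (min_le_right _ _).trans ?_
      have h4 : 1 / (2 * Q) * w ≤ a := by
        rw [one_div, inv_mul_le_iff₀ (by positivity)]
        have : Q * (D + a) ≤ Q * (a + a) := by gcongr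
        linarith
      have h5 := hΨmono.monotoneOn (show 1 / (2 * Q) * w ∈ Set.Ici (0 : ℝ) from by
        simp only [Set.mem_Ici]; positivity) ha h4
      linarith
  rw [one_div, inv_mul_le_iff₀ hC'pos]
  have e3 : (2 * Q + 2 / C₀) * D = 2 * Q * D + D / C₀ + D / C₀ := by ring
  linarith

end Aux2
/-- Theorem 3.8 (inverse bound under a PDE inversion condition of order β). -/
theorem pde_inversion_inverse_bound
    (d : ℕ) (hd : 1 ≤ d) (R lmin lmax : ℝ) (hR : 0 < R) (hlmin : 0 < lmin) (hl : lmin < lmax)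
    (f : Matrix (Fin d) (Fin d) ℝ → Euc d → ℝ)
    (hf_meas : ∀ A ∈ matSet d lmin lmax, Measurable (f A))
    (hf_nonneg : ∀ A ∈ matSet d lmin lmax, ∀ x, 0 ≤ f A x)
    (hf_int : ∀ A ∈ matSet d lmin lmax, ∫ x, f A x = 1)
    -- Assumption 1
    (C₀ : ℝ) (hC₀ : 0 < C₀) (Ψ : ℝ → ℝ)
    (hΨmono : StrictMonoOn Ψ (Set.Ici 0)) (hΨbij : Set.BijOn Ψ (Set.Ici 0) (Set.Ici 0))
    (hA1 : ∀ (P P' : Measure (Euc d)), IsProbabilityMeasure P → IsProbabilityMeasure P' →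
      P (closedBall 0 R)ᶜ = 0 → P' (closedBall 0 R)ᶜ = 0 →
      ∀ A ∈ matSet d lmin lmax, ∀ B ∈ matSet d lmin lmax,
        C₀ * Ψ (opNorm (A - B)) ≤ L1dist (mixDens (f A) P) (mixDens (f B) P'))
    -- PDE inversion condition of order β
    (β : ℕ) (hβ : 0 < β)
    (c : (Fin d → ℕ) → Matrix (Fin d) (Fin d) ℝ → ℝ) (L : ℝ) (hL : 0 < L)
    (hc_top : ∀ A ∈ matSet d lmin lmax, ∃ ν : Fin d → ℕ, (∑ i, ν i) = β ∧ c ν A ≠ 0)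
    (hc_lip : ∀ (ν : Fin d → ℕ), ∀ A ∈ matSet d lmin lmax, ∀ B ∈ matSet d lmin lmax,
        |c ν A - c ν B| ≤ L * opNorm (A - B))
    (hPDE : ∀ (P : Measure (Euc d)), IsProbabilityMeasure P →
      P (closedBall 0 R)ᶜ = 0 →
      ∀ A ∈ matSet d lmin lmax, ∀ φ : Euc d → ℝ, ContDiff ℝ (⊤ : ℕ∞) φ → HasCompactSupport φ →
        ∫ x, mixDens (f A) P x *
            (∑ ν ∈ multiIdxSet d β, (-1 : ℝ) ^ (∑ i, ν i) * c ν A * multiDeriv ν φ x) =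
          ∫ θ, φ θ ∂P) :
    ∃ C C' : ℝ, 0 < C ∧ 0 < C' ∧
      ∀ (P P' : Measure (Euc d)), IsProbabilityMeasure P → IsProbabilityMeasure P' →
        P (closedBall 0 R)ᶜ = 0 → P' (closedBall 0 R)ᶜ = 0 →
        ∀ A ∈ matSet d lmin lmax, ∀ B ∈ matSet d lmin lmax,
          C' * (Ψ (opNorm (A - B)) +
            min (W1 P P' ^ β) (Ψ (C * W1 P P' ^ β))) ≤
          L1dist (mixDens (f A) P) (mixDens (f B) P') := by
  classical
  rcases Set.eq_empty_or_nonempty (matSet d lmin lmax) with hS | ⟨A₀, hA₀⟩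
  · refine ⟨1, 1, one_pos, one_pos, ?_⟩
    intro P P' _ _ _ _ A hA
    rw [hS] at hA
    exact absurd hA (Set.notMem_empty _)
  have mp := fun A hA => fun P [IsProbabilityMeasure P] =>
    mix_props (hf_meas A hA) (hf_nonneg A hA) (hf_int A hA) P
  have hop : ∀ X : Matrix (Fin d) (Fin d) ℝ, 0 ≤ opNorm X := fun X => norm_nonneg _
  -- boundedness of the parameter set
  obtain ⟨t₀, ht₀, hΨt₀⟩ := hΨbij.surjOn (show 2 / C₀ ∈ Set.Ici (0 : ℝ) from by
    simp only [Set.mem_Ici]; positivity)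
  have hbdd : ∀ A ∈ matSet d lmin lmax, opNorm (A - A₀) ≤ t₀ := by
    intro A hA
    have hs : (Measure.dirac (0 : Euc d)) (closedBall 0 R)ᶜ = 0 := by
      rw [Measure.dirac_apply' _ isClosed_closedBall.measurableSet.compl]
      simp [hR.le]
    have h1 := hA1 (Measure.dirac 0) (Measure.dirac 0) inferInstance inferInstance hs hs
      A hA A₀ hA₀
    obtain ⟨p1, p2, p3⟩ := mp A hA (Measure.dirac 0)
    obtain ⟨q1, q2, q3⟩ := mp A₀ hA₀ (Measure.dirac 0)
    have h2 : L1dist (mixDens (f A) (Measure.dirac 0)) (mixDens (f A₀) (Measure.dirac 0)) ≤ 2 := by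
      calc L1dist (mixDens (f A) (Measure.dirac 0)) (mixDens (f A₀) (Measure.dirac 0))
          ≤ ∫ x, (mixDens (f A) (Measure.dirac 0) x + mixDens (f A₀) (Measure.dirac 0) x) := by
            refine integral_mono (p1.sub q1).abs (p1.add q1) fun x => ?_
            have a1 := p2 x
            have a2 := q2 x
            simp only [abs_le]
            constructor <;> linarith
        _ = 2 := by rw [integral_add p1 q1, p3, q3]; norm_num
    rw [← hΨmono.le_iff_le (hop _) ht₀, hΨt₀, le_div_iff₀ hC₀]
    linarith
  set I := multiIdxSet d β with hI
  set Mc : ℝ := ∑ ν ∈ I, |c ν A₀| + L * t₀ with hMc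
  have ht₀' : 0 ≤ t₀ := ht₀
  have hMc0 : 0 ≤ Mc := by positivity
  have hcM : ∀ A ∈ matSet d lmin lmax, ∀ ν ∈ I, |c ν A| ≤ Mc := by
    intro A hA ν hν
    have h1 := hc_lip ν A hA A₀ hA₀
    have h2 : L * opNorm (A - A₀) ≤ L * t₀ := by gcongr; exact hbdd A hA
    have h3 : |c ν A₀| ≤ ∑ ν ∈ I, |c ν A₀| :=
      Finset.single_le_sum (f := fun ν => |c ν A₀|) (fun _ _ => abs_nonneg _) hν
    have h4 : |c ν A| ≤ |c ν A - c ν A₀| + |c ν A₀| := by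
      simpa using abs_add_le (c ν A - c ν A₀) (c ν A₀)
    linarith
  obtain ⟨K, hK, happ⟩ := exists_approx d β hβ (2 * R) (2 * R) (by positivity) (by positivity)
  set N : ℝ := (I.card : ℝ) with hN
  have hN0 : 0 ≤ N := Nat.cast_nonneg _
  set Q : ℝ := (4 * (K + 1)) ^ β * (N * (Mc + L)) + 1 with hQ
  have hQ0 : 0 < Q := by positivity
  -- the central estimate
  have key : ∀ (P P' : Measure (Euc d)), IsProbabilityMeasure P → IsProbabilityMeasure P' →
        P (closedBall 0 R)ᶜ = 0 → P' (closedBall 0 R)ᶜ = 0 →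
        ∀ A ∈ matSet d lmin lmax, ∀ B ∈ matSet d lmin lmax,
        W1 P P' ^ β ≤ Q * (L1dist (mixDens (f A) P) (mixDens (f B) P') + opNorm (A - B)) := by
    intro P P' iP iP' hP hP' A hA B hB
    set D := L1dist (mixDens (f A) P) (mixDens (f B) P') with hD
    set a := opNorm (A - B) with ha
    have ha0 : 0 ≤ a := hop _
    have hD0 : 0 ≤ D := integral_nonneg fun x => abs_nonneg _
    have hW0 : 0 ≤ W1 P P' := W1_nonneg hP hP'
    have hW2 : W1 P P' ≤ 2 * R := W1_le hP hP' fun h hh h0 => diff_le hP hP' h hh h0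
    rcases hW0.eq_or_lt with hW | hW
    · rw [← hW, zero_pow hβ.ne']; positivity
    set W := W1 P P' with hWd
    set ε := W / (4 * (K + 1)) with hε
    have hε0 : 0 < ε := by positivity
    have hεW : W = 4 * (K + 1) * ε := by rw [hε]; field_simp
    have hεR : ε ≤ 2 * R := by nlinarith
    have hεβ : 0 < ε ^ β := by positivity
    have hWle : W ≤ 2 * (K * ε) + N * ((Mc * (K * ε / ε ^ β)) * D + (L * a) * (K * ε / ε ^ β)) := by
      refine W1_le hP hP' fun h hh h0 => ?_
      obtain ⟨g, hg, hgc, hgR, hgh⟩ := trunc hR hh h0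
      obtain ⟨φ, hφ, hφg, hφd⟩ := happ g hg hgc hgR ε hε0 hεR
      have hb : ∀ x : Euc d, ‖x‖ ≤ R → |h x| ≤ R := fun x hx => (lip_bound hh h0 x).trans hx
      have hb2 : ∀ x : Euc d, ‖x‖ ≤ R → |h x - φ x| ≤ K * ε := fun x hx => by
        rw [← hgh x hx, abs_sub_comm]; exact hφg x
      have hb3 : ∀ x : Euc d, ‖x‖ ≤ R → |φ x| ≤ R + K * ε := fun x hx => by
        have h1 := abs_le.1 (hb x hx)
        have h2 := abs_le.1 (hb2 x hx)
        rw [abs_le]; constructor <;> linarith [h1.1, h1.2, h2.1, h2.2]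
      have hcore := core (β := β) (mp A hA P).1 (mp B hB P').1 (mp B hB P').2.1 (mp B hB P').2.2 hφ
        (cA := fun ν => c ν A) (cB := fun ν => c ν B) (M := Mc) (B := K * ε / ε ^ β) (δ := L * a)
        (hcM A hA) (fun ν _ => hc_lip ν A hA B hB)
        (fun ν hν x => by rw [le_div_iff₀ hεβ, mul_comm]; exact hφd ν hν x)
      rw [hPDE P iP hP A hA φ hφ.1 hφ.2, hPDE P' iP' hP' B hB φ hφ.1 hφ.2] at hcore
      have d1 := (abs_le.1 (cont_int hP (hh.continuous.sub hφ.continuous) hb2).2).2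
      have d2 := (abs_le.1 (cont_int hP' (hh.continuous.sub hφ.continuous) hb2).2).1
      simp only [Pi.sub_apply] at d1 d2
      rw [integral_sub (cont_int hP hh.continuous hb).1 (cont_int hP hφ.continuous hb3).1] at d1
      rw [integral_sub (cont_int hP' hh.continuous hb).1 (cont_int hP' hφ.continuous hb3).1] at d2
      linarith
    exact arith_key hK hN0 hMc0 hL hD0 ha0 hε0 hεW hWle
  refine ⟨1 / (2 * Q), 1 / (2 * Q + 2 / C₀), by positivity, by positivity, ?_⟩
  intro P P' iP iP' hP hP' A hA B hB
  exact arith_final hC₀ hQ0 hΨmono (integral_nonneg fun x => abs_nonneg _)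
    (pow_nonneg (W1_nonneg hP hP') β) (hop _) (key P P' iP iP' hP hP' A hA B hB)
    (hA1 P P' iP iP' hP hP' A hA B hB)
end
end

section
/- There exist positive constants C and C' (depending only on d, R, λmin, λmax) such that for all Borel probability measures P, P' on ℝ^d supported in B̄(0,R) and all Σ, Σ' ∈ S, one has ‖p_{P,Σ} − p_{P',Σ'}‖₁ ≥ C' · (E_W + ‖Σ−Σ'‖_op²), where E_W := exp( − C / W₁(P,P') ) if W₁(P,P') > 0 and E_W := 0 otherwise. -/
open MeasureTheory Metric Real

noncomputable section

/-- The multivariate Cauchy kernel `f(x | θ, Σ)`. -/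
noncomputable def cauchyKer {d : ℕ} (A : Matrix (Fin d) (Fin d) ℝ) (θ x : Euc d) : ℝ :=
  Real.Gamma ((1 + d) / 2) /
    (π ^ (((d : ℝ) + 1) / 2) * Real.sqrt A.det *
      (1 + quadForm A⁻¹ (x - θ)) ^ (((d : ℝ) + 1) / 2))

/-- Cauchy mixture density. -/
noncomputable def cauchyMix {d : ℕ} (P : Measure (Euc d)) (A : Matrix (Fin d) (Fin d) ℝ) :
    Euc d → ℝ :=
  fun x => ∫ θ, cauchyKer A θ x ∂P


lemma schlomilch_aux (s : ℝ) (hs : 0 < s) :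
    ∫ u in Set.Ioi (0:ℝ), (1 / √u) * Real.exp (-u - s^2/(4*u)) = √π * Real.exp (-s) := by
  set E : ℝ → ℝ := fun u => Real.exp (-u - s^2/(4*u)) with hE
  have hEm : Measurable E := by fun_prop
  -- first change of variables
  let f : ℝ → ℝ := fun u => √u - s / (2 * √u)
  let f' : ℝ → ℝ := fun u => 1 / (2 * √u) + s / (4 * (u * √u))
  have hf' : ∀ x ∈ Set.Ioi (0:ℝ), HasDerivWithinAt f (f' x) (Set.Ioi 0) x := by
    intro x hx
    have hx0 : (0:ℝ) < x := hx
    have hsx : 0 < √x := Real.sqrt_pos.2 hx0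
    have h1 := Real.hasDerivAt_sqrt hx0.ne'
    have h2 := (h1.sub (((h1.const_mul 2).fun_inv (by positivity)).const_mul s))
    refine HasDerivAt.hasDerivWithinAt ?_
    have h3 : HasDerivAt f (1 / (2 * √x) - s * (-(2 * (1 / (2 * √x))) / (2 * √x) ^ 2)) x := h2
    have : √x ^ 2 = x := Real.sq_sqrt hx0.le
    have h4 : f' x = 1 / (2 * √x) - s * (-(2 * (1 / (2 * √x))) / (2 * √x) ^ 2) := by
      simp only [f']
      field_simp
      rw [this]; ring
    rw [h4]; exact h3
  have hinj : Set.InjOn f (Set.Ioi 0) := by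
    apply StrictMonoOn.injOn
    intro a ha b hb hab
    have ha0 : (0:ℝ) < a := ha
    have h1 : √a < √b := Real.sqrt_lt_sqrt ha0.le hab
    have h2 : 0 < √a := Real.sqrt_pos.2 ha0
    have h3 : s / (2 * √b) < s / (2 * √a) := by gcongr
    simp only [f]; linarith
  have himg : f '' (Set.Ioi 0) = Set.univ := by
    rw [Set.eq_univ_iff_forall]
    intro w
    have h0 : |w| < √(w^2 + 2*s) := by
      rw [← Real.sqrt_sq_eq_abs]; apply Real.sqrt_lt_sqrt (sq_nonneg _); linarith
    have h1 : √(w^2+2*s)^2 = w^2 + 2*s := Real.sq_sqrt (by positivity)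
    set q := √(w^2+2*s)
    have hv : 0 < (w + q)/2 := by
      have := neg_abs_le w; linarith
    refine ⟨((w+q)/2)^2, by simpa using by positivity, ?_⟩
    simp only [f]
    rw [Real.sqrt_sq hv.le]
    have hq : w + q ≠ 0 := by intro h; rw [h] at hv; simp at hv
    field_simp
    nlinarith
  have hA : ∫ w : ℝ, Real.exp (-1 * w^2) = ∫ u in Set.Ioi (0:ℝ), |f' u| • Real.exp (-1 * (f u)^2) := by
    rw [← integral_image_eq_integral_abs_deriv_smul measurableSet_Ioi hf' hinj (fun w => Real.exp (-1 * w^2)), himg, setIntegral_univ]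
  have hAi : IntegrableOn (fun u => |f' u| • Real.exp (-1 * (f u)^2)) (Set.Ioi 0) := by
    rw [← integrableOn_image_iff_integrableOn_abs_deriv_smul measurableSet_Ioi hf' hinj (fun w => Real.exp (-1 * w^2)), himg, integrableOn_univ]
    exact integrable_exp_neg_mul_sq one_pos
  have hrew : Set.EqOn (fun u => |f' u| • Real.exp (-1 * (f u)^2))
      (fun u => Real.exp s * ((1/2) * ((1 / √u) * E u) + (1/2) * ((s / (2 * (u * √u))) * E u))) (Set.Ioi 0) := by
    intro u hu
    have hu0 : (0:ℝ) < u := hu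
    have hsu : 0 < √u := Real.sqrt_pos.2 hu0
    have hsq : √u ^ 2 = u := Real.sq_sqrt hu0.le
    have e1 : -1 * (f u)^2 = s + (-u - s^2/(4*u)) := by
      simp only [f]
      have : (√u - s / (2 * √u))^2 = √u^2 - s + s^2/(4*√u^2) := by field_simp; ring
      rw [this, hsq]; ring
    have e2 : |f' u| = f' u := abs_of_pos (by simp only [f']; positivity)
    simp only [smul_eq_mul]
    rw [e1, e2, Real.exp_add]
    simp only [f', hE]
    field_simp
    ring
  have hS := hAi.congr_fun hrew measurableSet_Ioi
  rw [setIntegral_congr_fun measurableSet_Ioi hrew, integral_const_mul] at hA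
  have hS' : IntegrableOn (fun u => ((1/2) * ((1 / √u) * E u) + (1/2) * ((s / (2 * (u * √u))) * E u))) (Set.Ioi 0) := by
    have : IntegrableOn _ _ volume := hS.const_mul (Real.exp (-s))
    refine this.congr_fun ?_ measurableSet_Ioi
    intro u _
    simp only
    rw [← mul_assoc, ← Real.exp_add, neg_add_cancel, Real.exp_zero, one_mul]
  have hI1 : IntegrableOn (fun u => (1/2) * ((1 / √u) * E u)) (Set.Ioi 0) := by
    refine Integrable.mono' hS' (by fun_prop) ?_
    refine (ae_restrict_iff' measurableSet_Ioi).2 (Filter.Eventually.of_forall fun u hu => ?_)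
    have hu0 : (0:ℝ) < u := hu
    have hsu : 0 < √u := Real.sqrt_pos.2 hu0
    have hEp : 0 < E u := Real.exp_pos _
    rw [Real.norm_of_nonneg (by positivity)]
    have : 0 ≤ (1/2) * ((s / (2 * (u * √u))) * E u) := by positivity
    linarith
  have hI2 : IntegrableOn (fun u => (1/2) * ((s / (2 * (u * √u))) * E u)) (Set.Ioi 0) := by
    have : IntegrableOn _ _ volume := hS'.sub hI1
    refine this.congr_fun ?_ measurableSet_Ioi
    intro u _
    simp
  rw [integral_add hI1 hI2, integral_const_mul, integral_const_mul] at hA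
  -- second change of variables
  let g : ℝ → ℝ := fun u => s^2 / (4 * u)
  have hg' : ∀ x ∈ Set.Ioi (0:ℝ), HasDerivWithinAt g (-(s^2 / (4 * x^2))) (Set.Ioi 0) x := by
    intro x hx
    have hx0 : (0:ℝ) < x := hx
    have h2 := ((((hasDerivAt_id' x).const_mul 4).fun_inv (by positivity)).const_mul (s^2))
    refine HasDerivAt.hasDerivWithinAt ?_
    have h3 : HasDerivAt g (s^2 * (-(4 * 1) / (4 * x)^2)) x := h2
    have h4 : -(s^2 / (4 * x^2)) = s^2 * (-(4 * 1) / (4 * x)^2) := by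
      field_simp
      try ring
    rw [h4]; exact h3
  have hginj : Set.InjOn g (Set.Ioi 0) := by
    intro a ha b hb hab
    have ha0 : (0:ℝ) < a := ha
    have hb0 : (0:ℝ) < b := hb
    simp only [g] at hab
    field_simp at hab
    linarith
  have hgimg : g '' (Set.Ioi 0) = Set.Ioi 0 := by
    ext w
    constructor
    · rintro ⟨u, hu, rfl⟩
      have hu0 : (0:ℝ) < u := hu
      simp only [g, Set.mem_Ioi]; positivity
    · intro hw
      have hw0 : (0:ℝ) < w := hw
      refine ⟨s^2/(4*w), by simp only [Set.mem_Ioi]; positivity, ?_⟩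
      simp only [g]; field_simp
  have hB : ∫ u in Set.Ioi (0:ℝ), (1 / √u) * E u = ∫ u in Set.Ioi (0:ℝ), (s / (2 * (u * √u))) * E u := by
    have := integral_image_eq_integral_abs_deriv_smul measurableSet_Ioi hg' hginj (fun u => (1 / √u) * E u)
    rw [hgimg] at this
    rw [this]
    refine setIntegral_congr_fun measurableSet_Ioi ?_
    intro u hu
    have hu0 : (0:ℝ) < u := hu
    have hsu : 0 < √u := Real.sqrt_pos.2 hu0
    have hsq : √u ^ 2 = u := Real.sq_sqrt hu0.le
    have e1 : √(g u) = s / (2 * √u) := by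
      rw [Real.sqrt_eq_iff_mul_self_eq (by simp only [g]; positivity) (by positivity)]
      simp only [g]; field_simp; rw [hsq]; ring
    have e2 : E (g u) = E u := by
      simp only [hE, g]; congr 1; field_simp; ring
    simp only [smul_eq_mul]
    rw [abs_neg, abs_of_pos (by positivity), e1, e2]
    field_simp
    rw [hsq]; try ring
  rw [← hB, integral_gaussian] at hA
  rw [Real.exp_neg]
  simp only [div_one] at hA
  rw [hA]
  have := Real.exp_pos s
  generalize (∫ (u : ℝ) in Set.Ioi 0, 1 / √u * E u) = J
  field_simp
  ring

lemma schlomilch (s : ℝ) (hs : 0 ≤ s) :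
    ∫ u in Set.Ioi (0:ℝ), (1 / √u) * Real.exp (-u - s^2/(4*u)) = √π * Real.exp (-s) := by
  rcases hs.eq_or_lt with rfl | hs
  · have := Real.integral_rpow_mul_exp_neg_mul_Ioi (a := 1/2) (r := 1) (by norm_num) one_pos
    rw [Real.Gamma_one_half_eq] at this
    simp only [neg_zero, Real.exp_zero, mul_one]
    simp only [div_one, Real.one_rpow, one_mul] at this
    rw [← this]
    refine setIntegral_congr_fun measurableSet_Ioi ?_
    intro u hu
    have hu0 : (0:ℝ) < u := hu
    simp only
    rw [Real.sqrt_eq_rpow, one_div, ← Real.rpow_neg hu0.le]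
    norm_num
  · exact schlomilch_aux s hs


lemma gauss_inner {d : ℕ} (t : Euc d) (u : ℝ) (hu : 0 < u) :
    ∫ y : Euc d, Complex.exp ((inner ℝ y t : ℝ) * Complex.I) *
      ((u ^ (((d:ℝ)+1)/2 - 1) * Real.exp (-((1 + ‖y‖^2) * u)) : ℝ) : ℂ)
    = ((π ^ ((d:ℝ)/2) * ((1 / √u) * Real.exp (-u - ‖t‖^2/(4*u))) : ℝ) : ℂ) := by
  have h := GaussianFourier.integral_cexp_neg_mul_sq_norm_add_of_euclideanSpace (b := (u:ℂ)) (by simpa using hu) Complex.I t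
  have e : ∀ y : Euc d, Complex.exp ((inner ℝ y t : ℝ) * Complex.I) *
      ((u ^ (((d:ℝ)+1)/2 - 1) * Real.exp (-((1 + ‖y‖^2) * u)) : ℝ) : ℂ) =
      ((u ^ (((d:ℝ)+1)/2 - 1) * Real.exp (-u) : ℝ) : ℂ) * 
        Complex.exp (-(u:ℂ) * ‖y‖^2 + Complex.I * (inner ℝ t y : ℝ)) := by
    intro y
    rw [real_inner_comm]
    push_cast
    rw [mul_left_comm, mul_assoc, ← Complex.exp_add, ← Complex.exp_add]
    congr 2
    ring
  simp_rw [e]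
  rw [integral_const_mul, h]
  have h1 : ((π : ℂ) / u) ^ (((Fintype.card (Fin d) : ℕ) : ℂ) / 2) = (((π/u) ^ ((d:ℝ)/2) : ℝ) : ℂ) := by
    rw [Complex.ofReal_cpow (by positivity)]
    simp
  have h2 : Complex.I ^ 2 * (‖t‖:ℂ)^2 / (4 * u) = ((-(‖t‖^2/(4*u)) : ℝ) : ℂ) := by
    rw [Complex.I_sq]; push_cast; ring
  rw [h1, h2, ← Complex.ofReal_exp, ← Complex.ofReal_mul, ← Complex.ofReal_mul]
  congr 1
  rw [Real.div_rpow pi_pos.le hu.le, sub_eq_add_neg (-u), Real.exp_add]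
  have h3 : u ^ (((d:ℝ)+1)/2 - 1) = u ^ ((d:ℝ)/2) * (1/√u) := by
    rw [Real.sqrt_eq_rpow, one_div, ← Real.rpow_neg hu.le, ← Real.rpow_add hu]
    congr 1; ring
  rw [h3]
  have : 0 < u ^ ((d:ℝ)/2) := by positivity
  field_simp

lemma std_integrable (d : ℕ) : Integrable (fun y : Euc d => ((1 + ‖y‖^2) ^ (((d:ℝ)+1)/2))⁻¹) := by
  have := integrable_rpow_neg_one_add_norm_sq (E := Euc d) (μ := volume) (r := (d:ℝ)+1) (by simp)
  refine this.congr (Filter.Eventually.of_forall fun y => ?_)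
  simp only
  rw [neg_div, Real.rpow_neg (by positivity)]

lemma std_cauchy {d : ℕ} (t : Euc d) :
    (Real.Gamma (((d:ℝ)+1)/2) : ℂ) * ∫ y : Euc d, Complex.exp ((inner ℝ y t : ℝ) * Complex.I) *
      ((((1 + ‖y‖^2) ^ (((d:ℝ)+1)/2))⁻¹ : ℝ) : ℂ) = 
      ((π ^ (((d:ℝ)+1)/2) * Real.exp (-‖t‖) : ℝ) : ℂ) := by
  set a : ℝ := ((d:ℝ)+1)/2 with ha
  have ha0 : 0 < a := by positivity
  let G : Euc d → ℝ → ℝ := fun y u => u ^ (a - 1) * Real.exp (-((1 + ‖y‖^2) * u))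
  have hG : ∀ y, ∫ u in Set.Ioi (0:ℝ), G y u = ((1 + ‖y‖^2) ^ a)⁻¹ * Real.Gamma a := by
    intro y
    have := Real.integral_rpow_mul_exp_neg_mul_Ioi ha0 (r := 1 + ‖y‖^2) (by positivity)
    rw [this, one_div, Real.inv_rpow (by positivity)]
  have hGi : ∀ y, Integrable (G y) (volume.restrict (Set.Ioi 0)) := by
    intro y
    by_contra hcon
    have h1 := hG y
    rw [integral_undef hcon] at h1
    have h2 : 0 < Real.Gamma a := Real.Gamma_pos_of_pos ha0
    have : 0 < ((1 + ‖y‖^2) ^ a)⁻¹ * Real.Gamma a := by positivity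
    linarith
  let F : Euc d → ℝ → ℂ := fun y u => Complex.exp ((inner ℝ y t : ℝ) * Complex.I) * (G y u : ℂ)
  have hFm : Measurable (Function.uncurry F) := by
    simp only [F, G, Function.uncurry_def]
    fun_prop
  have hnorm : ∀ y u, ‖F y u‖ = ‖G y u‖ := by
    intro y u
    simp only [F, norm_mul, Complex.norm_exp_ofReal_mul_I, one_mul, Complex.norm_real]
  have hFi : Integrable (Function.uncurry F) ((volume : Measure (Euc d)).prod (volume.restrict (Set.Ioi (0:ℝ)))) := by
    rw [integrable_prod_iff hFm.aestronglyMeasurable]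
    constructor
    · refine Filter.Eventually.of_forall fun y => ?_
      have h1 : Integrable (fun u => (G y u : ℂ)) (volume.restrict (Set.Ioi (0:ℝ))) := (hGi y).ofReal
      exact h1.const_mul (Complex.exp ((inner ℝ y t : ℝ) * Complex.I))
    · have : (fun y => ∫ u in Set.Ioi (0:ℝ), ‖Function.uncurry F (y,u)‖) = fun y => ((1 + ‖y‖^2) ^ a)⁻¹ * Real.Gamma a := by
        funext y
        rw [← hG y]
        refine setIntegral_congr_fun measurableSet_Ioi fun u hu => ?_
        have hu0 : (0:ℝ) < u := hu
        simp only [Function.uncurry]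
        rw [hnorm, Real.norm_of_nonneg]
        simp only [G]; positivity
      rw [this]
      exact (std_integrable d).mul_const _
  have hswap := integral_integral_swap hFi
  have hL : ∀ y, ∫ u in Set.Ioi (0:ℝ), F y u = (Real.Gamma a : ℂ) * (Complex.exp ((inner ℝ y t : ℝ) * Complex.I) * ((((1 + ‖y‖^2) ^ a)⁻¹ : ℝ) : ℂ)) := by
    intro y
    simp only [F]
    rw [integral_const_mul, integral_complex_ofReal, hG y]
    push_cast; ring
  simp_rw [hL] at hswap
  rw [integral_const_mul] at hswap
  rw [hswap, setIntegral_congr_fun measurableSet_Ioi (fun u hu => gauss_inner t u hu), integral_complex_ofReal, integral_const_mul, schlomilch _ (norm_nonneg t)]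
  congr 1
  rw [ha, add_div, Real.rpow_add pi_pos, Real.sqrt_eq_rpow]; ring

section mats
open scoped Matrix

open Matrix in
lemma quadForm_eq {d : ℕ} (A : Matrix (Fin d) (Fin d) ℝ) (x : Euc d) :
    quadForm A x = x.ofLp ⬝ᵥ (A *ᵥ x.ofLp) := by
  simp only [quadForm, dotProduct, mulVec, Finset.mul_sum, mul_assoc]

open Matrix in
lemma inner_eq_dot {d : ℕ} (x y : Euc d) : inner ℝ x y = x.ofLp ⬝ᵥ y.ofLp := by
  simp only [PiLp.inner_apply, RCLike.inner_apply, conj_trivial, dotProduct]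
  exact Finset.sum_congr rfl fun i _ => mul_comm _ _

open Matrix in
lemma inner_toEuc {d : ℕ} (M : Matrix (Fin d) (Fin d) ℝ) (y t : Euc d) :
    inner ℝ (toEuclideanLin M y) t = inner ℝ y (toEuclideanLin Mᵀ t) := by
  rw [inner_eq_dot, inner_eq_dot, ofLp_toEuclideanLin_apply, ofLp_toEuclideanLin_apply,
    Matrix.dotProduct_mulVec, Matrix.vecMul_transpose]

lemma quadForm_inner {d : ℕ} (A : Matrix (Fin d) (Fin d) ℝ) (x : Euc d) :
    quadForm A x = inner ℝ x (Matrix.toEuclideanLin A x) := by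
  rw [quadForm_eq, inner_eq_dot, Matrix.ofLp_toEuclideanLin_apply]

open Matrix in
lemma norm_transpose {d : ℕ} (M : Matrix (Fin d) (Fin d) ℝ) (t : Euc d) :
    ‖toEuclideanLin Mᵀ t‖ = √(quadForm (M * Mᵀ) t) := by
  rw [@norm_eq_sqrt_real_inner, ← inner_toEuc, quadForm_inner, real_inner_comm]
  congr 2
  apply PiLp.ext; intro i
  simp [Matrix.mulVec_mulVec]

open Matrix in
lemma quadForm_inv {d : ℕ} (M : Matrix (Fin d) (Fin d) ℝ) (hM : M.det ≠ 0) (y : Euc d) :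
    quadForm (M * Mᵀ)⁻¹ (toEuclideanLin M y) = ‖y‖^2 := by
  rw [← real_inner_self_eq_norm_sq, quadForm_inner, inner_toEuc]
  congr 1
  apply PiLp.ext; intro i
  have hu : IsUnit M.det := isUnit_iff_ne_zero.2 hM
  have hu' : IsUnit Mᵀ.det := by rwa [Matrix.det_transpose]
  have : Mᵀ * ((M * Mᵀ)⁻¹ * M) = 1 := by
    rw [Matrix.mul_inv_rev, Matrix.mul_assoc, Matrix.nonsing_inv_mul _ hu, Matrix.mul_one, Matrix.mul_nonsing_inv _ hu']
  simp [Matrix.mulVec_mulVec, this]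

open Matrix in
open scoped MatrixOrder in
lemma matSet_factor {d : ℕ} {lmin lmax : ℝ} (hl : 0 < lmin) {A : Matrix (Fin d) (Fin d) ℝ}
    (hA : A ∈ matSet d lmin lmax) : ∃ M : Matrix (Fin d) (Fin d) ℝ, A = M * Mᵀ ∧ M.det ≠ 0 := by
  have hpd : A.PosDef := by
    refine Matrix.PosDef.of_dotProduct_mulVec_pos (by have := hA.1; rw [Matrix.IsHermitian, Matrix.conjTranspose_eq_transpose_of_trivial]; exact this) ?_
    intro x hx
    have h1 := (hA.2 (WithLp.toLp 2 x)).1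
    rw [quadForm_eq] at h1
    have : (WithLp.toLp 2 x : Euc d) ≠ 0 := by simpa using hx
    have h2 : 0 < ‖(WithLp.toLp 2 x : Euc d)‖ := norm_pos_iff.2 this
    have h3 : 0 < lmin * ‖(WithLp.toLp 2 x : Euc d)‖^2 := by positivity
    simpa using h3.trans_le h1
  have hdet := hpd.det_pos
  obtain ⟨B, hB⟩ := CStarAlgebra.nonneg_iff_eq_star_mul_self.mp hpd.posSemidef.nonneg
  refine ⟨Bᵀ, ?_, ?_⟩
  · rw [hB, Matrix.transpose_transpose, Matrix.star_eq_conjTranspose, Matrix.conjTranspose_eq_transpose_of_trivial]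
  · intro h
    rw [Matrix.det_transpose] at h
    rw [hB, Matrix.det_mul, h, mul_zero] at hdet
    exact lt_irrefl _ hdet

section cov
open scoped Matrix
variable {d : ℕ} {E : Type*} [NormedAddCommGroup E] [NormedSpace ℝ E]

lemma cov_facts (M : Matrix (Fin d) (Fin d) ℝ) (hM : M.det ≠ 0) (θ : Euc d) :
    Function.Injective (fun y : Euc d => θ + Matrix.toEuclideanLin M y) ∧
    (fun y : Euc d => θ + Matrix.toEuclideanLin M y) '' Set.univ = Set.univ ∧
    (∀ y ∈ (Set.univ : Set (Euc d)), HasFDerivWithinAt (fun y : Euc d => θ + Matrix.toEuclideanLin M y)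
      (LinearMap.toContinuousLinearMap (Matrix.toEuclideanLin M)) Set.univ y) ∧
    (LinearMap.toContinuousLinearMap (Matrix.toEuclideanLin M)).det = M.det := by
  have hdet : LinearMap.det (Matrix.toEuclideanLin M) = M.det := LinearMap.det_toLpLin 2 M
  have hu : IsUnit (LinearMap.det (Matrix.toEuclideanLin M)) := by rw [hdet]; exact isUnit_iff_ne_zero.2 hM
  let e := LinearEquiv.ofIsUnitDet (f := Matrix.toEuclideanLin M) (v := (EuclideanSpace.basisFun (Fin d) ℝ).toBasis) (v' := (EuclideanSpace.basisFun (Fin d) ℝ).toBasis) (by rwa [LinearMap.det_toMatrix])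
  have he : ∀ y, e y = Matrix.toEuclideanLin M y := fun y => rfl
  refine ⟨?_, ?_, ?_, ?_⟩
  · intro a b hab
    simp only [add_right_inj] at hab
    exact e.injective hab
  · rw [Set.image_univ, Set.range_eq_univ]
    intro x
    exact ⟨e.symm (x - θ), by simp only [← he]; simp⟩
  · intro y _
    exact (((LinearMap.toContinuousLinearMap (Matrix.toEuclideanLin M)).hasFDerivAt).const_add θ).hasFDerivWithinAt
  · rw [LinearMap.det_toContinuousLinearMap, hdet]

lemma cov_integral (M : Matrix (Fin d) (Fin d) ℝ) (hM : M.det ≠ 0) (θ : Euc d) (g : Euc d → E) :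
    ∫ x, g x = |M.det| • ∫ y, g (θ + Matrix.toEuclideanLin M y) := by
  obtain ⟨h1, h2, h3, h4⟩ := cov_facts M hM θ
  have := integral_image_eq_integral_abs_det_fderiv_smul volume MeasurableSet.univ h3 h1.injOn g
  rw [h2, h4, setIntegral_univ, setIntegral_univ, integral_smul] at this
  exact this

lemma cov_integrable (M : Matrix (Fin d) (Fin d) ℝ) (hM : M.det ≠ 0) (θ : Euc d) (g : Euc d → E) 
    (hg : Integrable (fun y => g (θ + Matrix.toEuclideanLin M y))) : Integrable g := by
  obtain ⟨h1, h2, h3, h4⟩ := cov_facts M hM θ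
  have := integrableOn_image_iff_integrableOn_abs_det_fderiv_smul volume MeasurableSet.univ h3 h1.injOn g
  rw [h2, h4, integrableOn_univ, integrableOn_univ] at this
  exact this.2 (hg.smul _)
end cov

lemma cauchyKer_comp {d : ℕ} (M : Matrix (Fin d) (Fin d) ℝ) (hM : M.det ≠ 0) (θ y : Euc d) :
    cauchyKer (M * Mᵀ) θ (θ + Matrix.toEuclideanLin M y) = 
      (|M.det|⁻¹ * (Real.Gamma (((d:ℝ)+1)/2) / π ^ (((d : ℝ) + 1) / 2))) * ((1 + ‖y‖^2) ^ (((d:ℝ)+1)/2))⁻¹ := by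
  rw [cauchyKer, add_sub_cancel_left, quadForm_inv M hM, Matrix.det_mul, Matrix.det_transpose, Real.sqrt_mul_self_eq_abs,
    add_comm (1:ℝ) (d:ℝ)]
  rw [div_eq_mul_inv, mul_inv, mul_inv]; ring

lemma cauchyKer_nonneg' {d : ℕ} (M : Matrix (Fin d) (Fin d) ℝ) (hM : M.det ≠ 0) (θ x : Euc d) :
    0 ≤ cauchyKer (M * Mᵀ) θ x := by
  have h := (cov_facts M hM θ).2.1
  obtain ⟨y, -, rfl⟩ : x ∈ (fun y : Euc d => θ + Matrix.toEuclideanLin M y) '' Set.univ := by rw [h]; trivial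
  simp only
  rw [cauchyKer_comp M hM]
  have := Real.Gamma_pos_of_pos (show (0:ℝ) < ((d:ℝ)+1)/2 by positivity)
  positivity

lemma cauchyKer_integrable' {d : ℕ} (M : Matrix (Fin d) (Fin d) ℝ) (hM : M.det ≠ 0) (θ : Euc d) :
    Integrable (cauchyKer (M * Mᵀ) θ) := by
  apply cov_integrable M hM θ
  simp_rw [cauchyKer_comp M hM]
  exact (std_integrable d).const_mul _

lemma cauchyKer_char' {d : ℕ} (M : Matrix (Fin d) (Fin d) ℝ) (hM : M.det ≠ 0) (θ t : Euc d) :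
    ∫ x, Complex.exp ((inner ℝ x t : ℝ) * Complex.I) * (cauchyKer (M * Mᵀ) θ x : ℂ) = 
      Complex.exp ((inner ℝ θ t : ℝ) * Complex.I) * (Real.exp (-√(quadForm (M * Mᵀ) t)) : ℂ) := by
  rw [cov_integral M hM θ]
  simp_rw [cauchyKer_comp M hM, inner_add_left, inner_toEuc]
  have hs := std_cauchy (Matrix.toEuclideanLin Mᵀ t)
  rw [norm_transpose] at hs
  have e : ∀ y : Euc d, Complex.exp (((inner ℝ θ t + inner ℝ y (Matrix.toEuclideanLin Mᵀ t) : ℝ) : ℂ) * Complex.I) *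
     ((|M.det|⁻¹ * (Real.Gamma (((d:ℝ)+1)/2) / π ^ (((d : ℝ) + 1) / 2)) * ((1 + ‖y‖^2) ^ (((d:ℝ)+1)/2))⁻¹ : ℝ) : ℂ) =
     ((|M.det|⁻¹ / π ^ (((d : ℝ) + 1) / 2) : ℝ) : ℂ) * Complex.exp ((inner ℝ θ t : ℝ) * Complex.I) * (Real.Gamma (((d:ℝ)+1)/2) : ℂ) * 
      (Complex.exp ((inner ℝ y (Matrix.toEuclideanLin Mᵀ t) : ℝ) * Complex.I) *
      ((((1 + ‖y‖^2) ^ (((d:ℝ)+1)/2))⁻¹ : ℝ) : ℂ)) := by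
    intro y
    rw [Complex.ofReal_add, add_mul, Complex.exp_add]
    push_cast
    ring
  simp_rw [e]
  rw [integral_const_mul, mul_assoc, hs, Complex.real_smul]
  have h1 : (|M.det| : ℝ) ≠ 0 := abs_ne_zero.2 hM
  have h2 : π ^ (((d : ℝ) + 1) / 2) ≠ 0 := by positivity
  have h3 : ((|M.det| : ℝ):ℂ) ≠ 0 := by exact_mod_cast h1
  have h4 : ((π ^ (((d : ℝ) + 1) / 2) : ℝ):ℂ) ≠ 0 := by exact_mod_cast h2
  rw [Complex.ofReal_mul, Complex.ofReal_div, Complex.ofReal_inv]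
  field_simp

lemma cauchyKer_measurable {d : ℕ} (A : Matrix (Fin d) (Fin d) ℝ) :
    Measurable (fun p : Euc d × Euc d => cauchyKer A p.1 p.2) := by
  unfold cauchyKer quadForm
  fun_prop

section mix

lemma cauchyKer_nonneg {d : ℕ} {lmin lmax : ℝ} (hl : 0 < lmin) {A : Matrix (Fin d) (Fin d) ℝ}
    (hA : A ∈ matSet d lmin lmax) (θ x : Euc d) : 0 ≤ cauchyKer A θ x := by
  obtain ⟨M, rfl, hM⟩ := matSet_factor hl hA
  exact cauchyKer_nonneg' M hM θ x

lemma cauchyKer_integrable {d : ℕ} {lmin lmax : ℝ} (hl : 0 < lmin) {A : Matrix (Fin d) (Fin d) ℝ}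
    (hA : A ∈ matSet d lmin lmax) (θ : Euc d) : Integrable (cauchyKer A θ) := by
  obtain ⟨M, rfl, hM⟩ := matSet_factor hl hA
  exact cauchyKer_integrable' M hM θ

lemma cauchyKer_char {d : ℕ} {lmin lmax : ℝ} (hl : 0 < lmin) {A : Matrix (Fin d) (Fin d) ℝ}
    (hA : A ∈ matSet d lmin lmax) (θ t : Euc d) :
    ∫ x, Complex.exp ((inner ℝ x t : ℝ) * Complex.I) * (cauchyKer A θ x : ℂ) = 
      Complex.exp ((inner ℝ θ t : ℝ) * Complex.I) * (Real.exp (-√(quadForm A t)) : ℂ) := by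
  obtain ⟨M, rfl, hM⟩ := matSet_factor hl hA
  exact cauchyKer_char' M hM θ t

lemma cauchyKer_integral {d : ℕ} {lmin lmax : ℝ} (hl : 0 < lmin) {A : Matrix (Fin d) (Fin d) ℝ}
    (hA : A ∈ matSet d lmin lmax) (θ : Euc d) : ∫ x, cauchyKer A θ x = 1 := by
  have := cauchyKer_char hl hA θ 0
  simp only [inner_zero_right, Complex.ofReal_zero, zero_mul, Complex.exp_zero, one_mul] at this
  rw [integral_complex_ofReal] at this
  have h0 : quadForm A 0 = 0 := by simp [quadForm]
  rw [h0] at this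
  simp at this
  exact_mod_cast this

lemma prod_integrable {d : ℕ} {lmin lmax : ℝ} (hl : 0 < lmin) {A : Matrix (Fin d) (Fin d) ℝ}
    (hA : A ∈ matSet d lmin lmax) (P : Measure (Euc d)) [IsProbabilityMeasure P] : Integrable (fun p : Euc d × Euc d => cauchyKer A p.1 p.2) (P.prod volume) := by
  rw [integrable_prod_iff (cauchyKer_measurable A).aestronglyMeasurable]
  refine ⟨Filter.Eventually.of_forall fun θ => cauchyKer_integrable hl hA θ, ?_⟩
  have : (fun θ : Euc d => ∫ x, ‖cauchyKer A θ x‖) = fun _ => 1 := by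
    funext θ
    rw [← cauchyKer_integral hl hA θ]
    congr 1; funext x
    exact Real.norm_of_nonneg (cauchyKer_nonneg hl hA θ x)
  simp only [this]
  exact integrable_const _

lemma mix_integrable {d : ℕ} {lmin lmax : ℝ} (hl : 0 < lmin) {A : Matrix (Fin d) (Fin d) ℝ}
    (hA : A ∈ matSet d lmin lmax) (P : Measure (Euc d)) [IsProbabilityMeasure P] : Integrable (cauchyMix P A) := (prod_integrable hl hA P).integral_prod_right

lemma mix_char {d : ℕ} {lmin lmax : ℝ} (hl : 0 < lmin) {A : Matrix (Fin d) (Fin d) ℝ}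
    (hA : A ∈ matSet d lmin lmax) (P : Measure (Euc d)) [IsProbabilityMeasure P] (t : Euc d) :
    ∫ x, Complex.exp ((inner ℝ x t : ℝ) * Complex.I) * (cauchyMix P A x : ℂ) = 
      charFun P t * (Real.exp (-√(quadForm A t)) : ℂ) := by
  have h1 : Integrable (Function.uncurry fun θ x : Euc d => Complex.exp ((inner ℝ x t : ℝ) * Complex.I) * (cauchyKer A θ x : ℂ)) (P.prod volume) := by
    have h2 : Integrable (fun p : Euc d × Euc d => (cauchyKer A p.1 p.2 : ℂ)) (P.prod volume) := (prod_integrable hl hA P).ofReal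
    refine h2.mono ?_ (Filter.Eventually.of_forall fun p => ?_)
    · apply Measurable.aestronglyMeasurable
      have := cauchyKer_measurable A
      simp only [Function.uncurry_def]
      fun_prop
    · simp only [Function.uncurry_def, norm_mul, Complex.norm_exp_ofReal_mul_I, one_mul]; rfl
  have h3 := integral_integral_swap h1
  simp_rw [cauchyKer_char hl hA, integral_const_mul, integral_complex_ofReal] at h3
  rw [integral_mul_const] at h3
  rw [charFun_apply]
  exact h3.symm
end mix
end mats


lemma exists_kernel (d : ℕ) : ∃ ψ K : Euc d → ℂ, Integrable ψ ∧ Continuous ψ ∧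
    (∀ w, 1 / (2 * π) < ‖w‖ → ψ w = 0) ∧ Integrable K ∧ Continuous K ∧
    Integrable (fun y => ‖y‖ * ‖K y‖) ∧ ∫ y, K y = 1 ∧
    ∀ x, K x = ∫ w, Complex.exp (((-2 * π * inner ℝ w x : ℝ) : ℂ) * Complex.I) * ψ w := by
  have hpi := pi_pos
  let b : ContDiffBump (0 : Euc d) := ⟨1/(4*π), 1/(2*π), by positivity, by gcongr; norm_num⟩
  let f : Euc d → ℂ := fun w => ((b w : ℝ) : ℂ)
  have hf1 : HasCompactSupport f := b.hasCompactSupport.comp_left (g := fun r : ℝ => (r : ℂ)) (by simp)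
  have hf2 : ContDiff ℝ (⊤ : ℕ∞) f := Complex.ofRealCLM.contDiff.comp b.contDiff
  let φ : SchwartzMap (Euc d) ℂ := hf1.toSchwartzMap hf2
  let κ : SchwartzMap (Euc d) ℂ := FourierTransform.fourier φ
  refine ⟨φ, κ, φ.integrable, φ.continuous, ?_, κ.integrable, κ.continuous, ?_, ?_, ?_⟩
  · intro w hw
    have : b w = 0 := b.zero_of_le_dist (by rw [dist_zero_right]; exact hw.le)
    change ((b w : ℝ) : ℂ) = 0
    rw [this]; simp
  · simpa using κ.integrable_pow_mul volume 1
  · have h1 : (FourierTransformInv.fourierInv κ) = φ := FourierTransform.fourierInv_fourier_eq φ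
    have h2 : (FourierTransformInv.fourierInv κ) 0 = φ 0 := by rw [h1]
    have h3 : (FourierTransformInv.fourierInv κ) 0 = FourierTransformInv.fourierInv (κ : Euc d → ℂ) 0 := by
      rw [← SchwartzMap.fourierInv_coe]
    rw [h3, Real.fourierInv_eq'] at h2
    simp at h2
    rw [h2]
    change ((b 0 : ℝ) : ℂ) = 1
    have : b 0 = 1 := b.one_of_mem_closedBall (by simp [b]; positivity)
    rw [this]; simp
  · intro x
    have : κ x = FourierTransform.fourier (φ : Euc d → ℂ) x := by
      rw [← SchwartzMap.fourier_coe]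
    rw [this, Real.fourier_eq']
    simp only [smul_eq_mul]

lemma smoothing_aux {d : ℕ} {ψ K : Euc d → ℂ} (hψi : Integrable ψ) (hψc : Continuous ψ)
    (hψs : ∀ w, 1 / (2 * π) < ‖w‖ → ψ w = 0) (hKi : Integrable K) (hKc : Continuous K)
    (hKm : Integrable (fun y => ‖y‖ * ‖K y‖)) (hK1 : ∫ y, K y = 1)
    (hKψ : ∀ x, K x = ∫ w, Complex.exp (((-2 * π * inner ℝ w x : ℝ) : ℂ) * Complex.I) * ψ w)
    {h : Euc d → ℝ} (hL : LipschitzWith 1 h) (hhi : Integrable h) {Bd : ℝ} (hB : ∀ x, |h x| ≤ Bd)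
    (P P' : Measure (Euc d)) [IsProbabilityMeasure P] [IsProbabilityMeasure P']
    {T η : ℝ} (hT : 0 < T) (hη : ∀ t, ‖t‖ ≤ T → ‖charFun P t - charFun P' t‖ ≤ η) :
    |(∫ x, h x ∂P) - ∫ x, h x ∂P'| ≤ 2 * (∫ y, ‖y‖ * ‖K y‖) / T + T^d * ((∫ x, |h x|) * ∫ w, ‖ψ w‖) * η := by
  have hhc : Continuous h := hL.continuous
  have hT' := hT.ne'
  set C1 := ∫ y, ‖y‖ * ‖K y‖ with hC1
  let H : Euc d → ℂ := fun x => ∫ y, (h (x - T⁻¹ • y) : ℂ) * K y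
  have hKint : ∀ (x : Euc d), Integrable (fun y => (h (x - T⁻¹ • y) : ℂ) * K y) := by
    intro x
    refine hKi.bdd_mul (c := Bd) (by fun_prop) (Filter.Eventually.of_forall fun y => ?_)
    simpa using hB _
  have hclose : ∀ x, ‖(h x : ℂ) - H x‖ ≤ C1 / T := by
    intro x
    have e1 : (h x : ℂ) - H x = ∫ y, ((h x : ℂ) * K y - (h (x - T⁻¹ • y) : ℂ) * K y) := by
      rw [integral_sub (hKi.const_mul _) (hKint x), integral_const_mul, hK1, mul_one]
    rw [e1, div_eq_inv_mul, hC1, ← integral_const_mul]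
    refine norm_integral_le_of_norm_le (hKm.const_mul _) (Filter.Eventually.of_forall fun y => ?_)
    rw [← sub_mul, norm_mul, ← mul_assoc, ← Complex.ofReal_sub, Complex.norm_real]
    gcongr
    have := hL.dist_le_mul x (x - T⁻¹ • y)
    rw [dist_eq_norm, dist_eq_norm, sub_sub_cancel, norm_smul] at this
    simpa [abs_of_pos hT] using this
  let Φ : Euc d → Euc d × Euc d → ℂ := fun x p =>
    ((h p.1 : ℂ) * ψ p.2) * Complex.exp (((-2 * π * inner ℝ p.2 (T • (x - p.1)) : ℝ) : ℂ) * Complex.I)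
  let base : Euc d × Euc d → ℂ := fun p => (h p.1 : ℂ) * ψ p.2
  have hbase : Integrable base := by
    have : Integrable (fun z => (h z : ℂ)) := hhi.ofReal
    exact this.mul_prod hψi
  have hΦn : ∀ x p, ‖Φ x p‖ = ‖base p‖ := by
    intro x p
    simp only [Φ, base]
    rw [norm_mul, Complex.norm_exp_ofReal_mul_I, mul_one]
  have hΦc : Continuous (Function.uncurry Φ) := by
    simp only [Φ, Function.uncurry_def]
    fun_prop
  have hΦx : ∀ x, Integrable (Φ x) := by
    intro x
    refine hbase.mono (Continuous.aestronglyMeasurable (by fun_prop)) (Filter.Eventually.of_forall fun p => (hΦn x p).le)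
  have hH : ∀ x, H x = (T^d : ℝ) • ∫ p, Φ x p := by
    intro x
    let g : Euc d → ℂ := fun z => (h z : ℂ) * K (T • (x - z))
    have e1 : H x = ∫ y, (fun y => g (x - y)) (T⁻¹ • y) := by
      simp only [H, g]
      congr 1; funext y
      rw [sub_sub_cancel, smul_smul, mul_inv_cancel₀ hT', one_smul]
    have e2 := Measure.integral_comp_inv_smul volume (fun y => g (x - y)) T
    rw [integral_sub_left_eq_self g volume x, finrank_euclideanSpace_fin,
      abs_of_pos (by positivity : (0:ℝ) < T ^ d)] at e2
    have e3 : ∫ p, Φ x p = ∫ z, ∫ w, Φ x (z, w) := by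
      rw [Measure.volume_eq_prod]
      exact integral_prod _ (hΦx x)
    rw [e1, e3]
    refine e2.trans ?_
    congr 1
    congr 1; funext z
    simp only [g, Φ]
    rw [hKψ, ← integral_const_mul]
    congr 1; funext w
    ring
  have key : ∀ (Q : Measure (Euc d)) [IsProbabilityMeasure Q], Integrable H Q ∧
      ∃ G : Euc d × Euc d → ℂ, Integrable G ∧ (∀ p, G p = base p * (Complex.exp (((2 * π * T * inner ℝ p.2 p.1 : ℝ) : ℂ) * Complex.I)
        * charFun Q (-(2 * π * T) • p.2))) ∧ ∫ x, H x ∂Q = (T^d : ℝ) • ∫ p, G p := by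
    intro Q _
    have hi : Integrable (Function.uncurry Φ) (Q.prod volume) := by
      have h1 : Integrable (fun q : Euc d × (Euc d × Euc d) => (1:ℂ) * base q.2) (Q.prod volume) :=
        (integrable_const (1:ℂ)).mul_prod hbase
      refine h1.mono hΦc.aestronglyMeasurable (Filter.Eventually.of_forall fun q => ?_)
      rw [one_mul]
      exact (hΦn q.1 q.2).le
    have hHeq : H = fun x => (T^d : ℝ) • ∫ p, Φ x p := funext hH
    refine ⟨?_, fun p => ∫ x, Φ x p ∂Q, hi.integral_prod_right, ?_, ?_⟩
    · rw [hHeq]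
      have h1 : Integrable (fun x => ∫ p, Φ x p) Q := hi.integral_prod_left
      exact h1.smul (T^d : ℝ)
    · intro p
      simp only [Φ, base]
      rw [charFun_apply, ← integral_const_mul, ← integral_const_mul]
      congr 1; funext x
      rw [← Complex.exp_add]
      congr 1
      congr 1
      rw [inner_smul_right, inner_smul_right, inner_sub_right, real_inner_comm x p.2]
      push_cast
      ring
    · rw [hHeq, integral_smul, integral_integral_swap hi]
  obtain ⟨hHP, G, hGi, hG, hGe⟩ := key P
  obtain ⟨hHP', G', hGi', hG', hGe'⟩ := key P'
  have hη0 : 0 ≤ η := (norm_nonneg _).trans (hη 0 (by simpa using hT.le))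
  have hdiff : ‖(∫ x, H x ∂P) - ∫ x, H x ∂P'‖ ≤ T^d * ((∫ x, |h x|) * ∫ w, ‖ψ w‖) * η := by
    rw [hGe, hGe', ← smul_sub, ← integral_sub hGi hGi', norm_smul, Real.norm_of_nonneg (by positivity), mul_assoc]
    gcongr
    have e2 : ((∫ x, |h x|) * ∫ w, ‖ψ w‖) * η = ∫ p : Euc d × Euc d, (|h p.1| * ‖ψ p.2‖) * η := by
      rw [integral_mul_const, Measure.volume_eq_prod, integral_prod_mul (fun x => |h x|) (fun w => ‖ψ w‖)]
    rw [e2]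
    refine norm_integral_le_of_norm_le ((hhi.abs.mul_prod hψi.norm).mul_const η) (Filter.Eventually.of_forall fun p => ?_)
    rw [hG, hG', ← mul_sub, ← mul_sub, norm_mul, norm_mul (Complex.exp _), Complex.norm_exp_ofReal_mul_I, one_mul]
    simp only [base, norm_mul, Complex.norm_real, Real.norm_eq_abs]
    by_cases hw : 1 / (2 * π) < ‖p.2‖
    · rw [hψs _ hw]; simp
    · gcongr
      apply hη
      rw [norm_smul, norm_neg, Real.norm_of_nonneg (by positivity)]
      have h5 : ‖p.2‖ ≤ 1 / (2 * π) := not_lt.1 hw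
      calc 2 * π * T * ‖p.2‖ ≤ 2 * π * T * (1 / (2 * π)) := by gcongr
        _ = T := by field_simp
  have hintg : ∀ (Q : Measure (Euc d)) [IsProbabilityMeasure Q], Integrable (fun x => (h x : ℂ)) Q := by
    intro Q _
    refine Integrable.of_bound (C := Bd) (by fun_prop) (Filter.Eventually.of_forall fun y => ?_)
    simpa using hB _
  have hside : ∀ (Q : Measure (Euc d)) [IsProbabilityMeasure Q], Integrable H Q → ‖(∫ x, (h x : ℂ) ∂Q) - ∫ x, H x ∂Q‖ ≤ C1 / T := by
    intro Q _ hHQ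
    rw [← integral_sub (hintg Q) hHQ]
    have := norm_integral_le_of_norm_le_const (μ := Q) (Filter.Eventually.of_forall hclose)
    simpa using this
  have h6 := hside P hHP
  have h7 := hside P' hHP'
  have e3 : |(∫ x, h x ∂P) - ∫ x, h x ∂P'| = ‖(∫ x, (h x : ℂ) ∂P) - ∫ x, (h x : ℂ) ∂P'‖ := by
    rw [integral_complex_ofReal, integral_complex_ofReal, ← Complex.ofReal_sub, Complex.norm_real, Real.norm_eq_abs]
  rw [e3]
  have e4 : (∫ x, (h x : ℂ) ∂P) - ∫ x, (h x : ℂ) ∂P' = ((∫ x, (h x : ℂ) ∂P) - ∫ x, H x ∂P) - ((∫ x, (h x : ℂ) ∂P') - ∫ x, H x ∂P')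
     + ((∫ x, H x ∂P) - ∫ x, H x ∂P') := by ring
  rw [e4]
  refine (norm_add_le _ _).trans ?_
  have := norm_sub_le ((∫ x, (h x : ℂ) ∂P) - ∫ x, H x ∂P) ((∫ x, (h x : ℂ) ∂P') - ∫ x, H x ∂P')
  have e5 : 2 * C1 / T = C1 / T + C1 / T := by ring
  rw [e5]
  linarith

lemma smoothing (d : ℕ) (R : ℝ) (hR : 0 < R) : ∃ C1 C2 : ℝ, 0 < C1 ∧ 0 < C2 ∧
    ∀ (P P' : Measure (Euc d)), IsProbabilityMeasure P → IsProbabilityMeasure P' →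
        P (closedBall 0 R)ᶜ = 0 → P' (closedBall 0 R)ᶜ = 0 →
    ∀ T η : ℝ, 0 < T → (∀ t, ‖t‖ ≤ T → ‖charFun P t - charFun P' t‖ ≤ η) →
    W1 P P' ≤ C1 / T + C2 * T^d * η := by
  obtain ⟨ψ, K, hψi, hψc, hψs, hKi, hKc, hKm, hK1, hKψ⟩ := exists_kernel d
  have hC10 : 0 ≤ ∫ y, ‖y‖ * ‖K y‖ := integral_nonneg fun y => by positivity
  have hψ0 : 0 ≤ ∫ w, ‖ψ w‖ := integral_nonneg fun y => by positivity
  let V : ℝ := volume.real (closedBall (0 : Euc d) (2*R))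
  have hV0 : 0 ≤ V := measureReal_nonneg
  refine ⟨2 * (∫ y, ‖y‖ * ‖K y‖) + 1, (2*R*V) * (∫ w, ‖ψ w‖) + 1, by positivity, by positivity, ?_⟩
  intro P P' hP hP' hPs hPs' T η hT hη
  have hη0 : 0 ≤ η := (norm_nonneg _).trans (hη 0 (by simpa using hT.le))
  have hsupp : ∀ Q : Measure (Euc d), Q (closedBall 0 R)ᶜ = 0 → ∀ᵐ x ∂Q, ‖x‖ ≤ R := by
    intro Q hQ
    rw [ae_iff]
    convert hQ using 2
    ext x; simp
  refine csSup_le ⟨0, fun _ => 0, LipschitzWith.of_dist_le_mul (by intro x y; simp), by simp⟩ ?_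
  rintro r ⟨h, hL, rfl⟩
  let g : Euc d → ℝ := fun x => max 0 (2*R - ‖x‖)
  have hgL : LipschitzWith 1 g := by
    have h1 : LipschitzWith 1 (fun x : Euc d => 2*R - ‖x‖) := by
      apply LipschitzWith.of_dist_le_mul
      intro x y
      rw [Real.dist_eq, NNReal.coe_one, one_mul, dist_eq_norm]
      have : 2*R - ‖x‖ - (2*R - ‖y‖) = ‖y‖ - ‖x‖ := by ring
      rw [this, norm_sub_rev]
      exact abs_norm_sub_norm_le y x
    exact h1.const_max 0
  let k : Euc d → ℝ := fun x => h x - h 0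
  have hkL : LipschitzWith 1 k := by
    apply LipschitzWith.of_dist_le_mul
    intro x y
    have := hL.dist_le_mul x y
    simpa [k, Real.dist_eq] using this
  let q : Euc d → ℝ := fun x => max (-(g x)) (min (g x) (k x))
  have hqL : LipschitzWith 1 q := by
    have := hgL.neg.max (hgL.min hkL)
    simpa using this
  have hg0 : ∀ x, 0 ≤ g x := fun x => le_max_left _ _
  have hqg : ∀ x, |q x| ≤ g x := by
    intro x
    rw [abs_le]
    exact ⟨le_max_left _ _, max_le (by have := hg0 x; linarith) (min_le_left _ _)⟩
  have hg2 : ∀ x, g x ≤ 2*R := fun x => max_le (by positivity) (by have := norm_nonneg x; linarith)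
  have hq2 : ∀ x, |q x| ≤ 2*R := fun x => (hqg x).trans (hg2 x)
  have hind : ∀ x, |q x| ≤ (closedBall (0 : Euc d) (2*R)).indicator (fun _ => 2*R) x := by
    intro x
    by_cases hx : x ∈ closedBall (0 : Euc d) (2*R)
    · rw [Set.indicator_of_mem hx]; exact hq2 x
    · rw [Set.indicator_of_notMem hx]
      refine (hqg x).trans ?_
      simp at hx
      exact max_le le_rfl (by linarith)
  have hindi : Integrable ((closedBall (0 : Euc d) (2*R)).indicator (fun _ => 2*R)) := by
    rw [integrable_indicator_iff measurableSet_closedBall]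
    exact integrableOn_const (isCompact_closedBall _ _).measure_lt_top.ne
  have hqi : Integrable q := by
    refine hindi.mono' hqL.continuous.aestronglyMeasurable (Filter.Eventually.of_forall hind)
  have hq1 : ∫ x, |q x| ≤ 2*R*V := by
    refine (integral_mono hqi.abs hindi hind).trans ?_
    rw [integral_indicator measurableSet_closedBall, setIntegral_const, smul_eq_mul, mul_comm]
  have hqk : ∀ x, ‖x‖ ≤ R → q x = h x - h 0 := by
    intro x hx
    have h1 : |k x| ≤ ‖x‖ := by
      have := hL.dist_le_mul x 0
      simpa [k, Real.dist_eq] using this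
    have h2 : R ≤ g x := by
      simp only [g]; exact le_max_of_le_right (by linarith)
    have h3 := abs_le.1 (h1.trans (hx.trans h2))
    simp only [q]
    rw [min_eq_right h3.2, max_eq_right h3.1]
  have hQ : ∀ Q : Measure (Euc d), IsProbabilityMeasure Q → Q (closedBall 0 R)ᶜ = 0 → ∫ x, h x ∂Q = (∫ x, q x ∂Q) + h 0 := by
    intro Q hQp hQs
    have hqQ : Integrable q Q := Integrable.of_bound (C := 2*R) hqL.continuous.aestronglyMeasurable (Filter.Eventually.of_forall hq2)
    have : ∫ x, h x ∂Q = ∫ x, (q x + h 0) ∂Q := by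
      refine integral_congr_ae ?_
      filter_upwards [hsupp Q hQs] with x hx
      rw [hqk x hx]; ring
    rw [this, integral_add hqQ (integrable_const _)]
    simp
  rw [hQ P hP hPs, hQ P' hP' hPs', add_sub_add_right_eq_sub]
  refine (le_abs_self _).trans ?_
  refine (smoothing_aux hψi hψc hψs hKi hKc hKm hK1 hKψ hqL hqi hq2 P P' hT hη).trans ?_
  rw [mul_comm (T^d)]
  gcongr
  · linarith
  · have : (∫ x, |q x|) * (∫ w, ‖ψ w‖) ≤ 2*R*V * ∫ w, ‖ψ w‖ := by gcongr
    linarith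


lemma real_key {R L a b e : ℝ} (hR : 0 < R) (hL : 0 < L) (ha : 0 ≤ a) (hab : a ≤ b) (hb : b ≤ L)
    (h : ∀ s, 0 ≤ s → (1 - s^2*R^2/2) * exp (-(s*a)) - exp (-(s*b)) ≤ e) :
    (b - a)^2 ≤ 4 * exp 1 * (R^2 + L^2) * e := by
  obtain ⟨δ, hδ⟩ : ∃ δ, δ = b - a := ⟨_, rfl⟩
  have hδ0 : 0 ≤ δ := by linarith
  have hδL : δ ≤ L := by linarith
  have hb' : b = a + δ := by linarith
  subst hb'
  rw [← hδ]
  set N := R^2 + L^2 with hN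
  have hN0 : 0 < N := by positivity
  set s := δ / (2*N) with hs
  have hs0 : 0 ≤ s := by positivity
  have h1 := h s hs0
  have hsd : s * (2*N) = δ := by rw [hs]; field_simp
  have hsa : s * a ≤ 1 := by
    have : s * a * (2*N) ≤ 1 * (2*N) := by nlinarith [sq_nonneg R]
    exact le_of_mul_le_mul_right this (by positivity)
  have he : exp (-(s*(a+δ))) = exp (-(s*a)) * exp (-(s*δ)) := by rw [← exp_add]; congr 1; ring
  have hx0 : 0 ≤ s*δ := by positivity
  have hx : exp (-(s*δ)) ≤ 1 - s*δ + (s*δ)^2 := by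
    rw [exp_neg]
    have h2 := add_one_le_exp (s*δ)
    rw [inv_le_iff_one_le_mul₀ (exp_pos _)]
    have h3 : 0 ≤ 1 - s*δ + (s*δ)^2 := by nlinarith [sq_nonneg (s*δ - 1)]
    calc (1:ℝ) ≤ (1 - s*δ + (s*δ)^2) * (s*δ+1) := by nlinarith [pow_nonneg hx0 3]
      _ ≤ _ := by gcongr
  have hlow : s*δ/2 ≤ (1 - s^2*R^2/2) - exp (-(s*δ)) := by
    have h4 : (s*δ)^2 + s^2*R^2/2 ≤ s^2 * N := by
      have : δ^2 ≤ L^2 := by gcongr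
      rw [hN]; nlinarith [sq_nonneg s, sq_nonneg (s*R), mul_le_mul_of_nonneg_left this (sq_nonneg s)]
    have h5 : s^2*N = s*δ/2 := by rw [← hsd]; ring
    linarith
  have h6 : exp (-1) * (s*δ/2) ≤ e := by
    calc exp (-1) * (s*δ/2) ≤ exp (-(s*a)) * ((1 - s^2*R^2/2) - exp (-(s*δ))) := by gcongr
      _ = _ := by rw [mul_sub, ← he]; ring
      _ ≤ e := h1
  have h7 : δ^2 = 4 * exp 1 * N * (exp (-1) * (s*δ/2)) := by
    have : exp 1 * exp (-1) = 1 := by rw [← exp_add]; simp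
    calc δ^2 = (s*(2*N)) * δ * (exp 1 * exp (-1)) := by rw [hsd, this]; ring
      _ = _ := by ring
  rw [h7]
  gcongr

lemma char_diff {d : ℕ} {lmin lmax : ℝ} (hl : 0 < lmin) {A B : Matrix (Fin d) (Fin d) ℝ}
    (hA : A ∈ matSet d lmin lmax) (hB : B ∈ matSet d lmin lmax)
    (P P' : Measure (Euc d)) [IsProbabilityMeasure P] [IsProbabilityMeasure P'] (t : Euc d) :
    ‖charFun P t * (Real.exp (-√(quadForm A t)) : ℂ) - charFun P' t * (Real.exp (-√(quadForm B t)) : ℂ)‖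
      ≤ ∫ x, |cauchyMix P A x - cauchyMix P' B x| := by
  have hi : ∀ {f : Euc d → ℝ}, Integrable f →
      Integrable (fun x => Complex.exp (((inner ℝ x t : ℝ) : ℂ) * Complex.I) * (f x : ℂ)) := by
    intro f hf
    refine hf.ofReal.bdd_mul (c := 1) (Continuous.aestronglyMeasurable (by fun_prop))
      (Filter.Eventually.of_forall fun x => ?_)
    rw [Complex.norm_exp_ofReal_mul_I]
  have iA := mix_integrable hl hA P
  have iB := mix_integrable hl hB P'
  rw [← mix_char hl hA P t, ← mix_char hl hB P' t, ← integral_sub (hi iA) (hi iB)]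
  refine norm_integral_le_of_norm_le (iA.sub iB).abs (Filter.Eventually.of_forall fun x => ?_)
  rw [← mul_sub, norm_mul, Complex.norm_exp_ofReal_mul_I, one_mul, ← Complex.ofReal_sub, Complex.norm_real]
  exact le_rfl

lemma charFun_lower {d : ℕ} {R : ℝ} (P : Measure (Euc d)) [IsProbabilityMeasure P]
    (hP : P (closedBall 0 R)ᶜ = 0) (t : Euc d) :
    1 - ‖t‖^2 * R^2/2 ≤ ‖charFun P t‖ := by
  refine le_trans ?_ (Complex.re_le_norm _)
  have hintg : Integrable (fun x : Euc d => Complex.exp (((inner ℝ x t : ℝ) : ℂ) * Complex.I)) P := by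
    refine Integrable.of_bound (C := 1) (Continuous.aestronglyMeasurable (by fun_prop)) (Filter.Eventually.of_forall fun y => ?_)
    rw [Complex.norm_exp_ofReal_mul_I]
  rw [charFun_apply]
  have e := integral_re hintg
  simp only [RCLike.re_eq_complex_re] at e
  rw [← e]
  have : 1 - ‖t‖^2 * R^2/2 = ∫ x, (1 - ‖t‖^2 * R^2/2) ∂P := by simp
  rw [this]
  refine integral_mono_ae (integrable_const _) hintg.re ?_
  have hs : ∀ᵐ x ∂P, ‖x‖ ≤ R := by
    rw [ae_iff]
    convert hP using 2
    ext x; simp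
  filter_upwards [hs] with x hx
  simp only [RCLike.re_eq_complex_re, Complex.exp_ofReal_mul_I_re]
  have h1 := Real.one_sub_sq_div_two_le_cos (x := inner ℝ x t)
  have h2 : (inner ℝ x t)^2 ≤ ‖t‖^2 * R^2 := by
    have := abs_real_inner_le_norm x t
    rw [← sq_abs (inner ℝ x t), ← mul_pow]
    have h3 : |inner ℝ x t| ≤ ‖t‖ * R := this.trans (by rw [mul_comm]; gcongr)
    gcongr
  linarith

lemma quadForm_smul {d : ℕ} (A : Matrix (Fin d) (Fin d) ℝ) (s : ℝ) (x : Euc d) :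
    quadForm A (s • x) = s^2 * quadForm A x := by
  simp only [quadForm, Finset.mul_sum]
  refine Finset.sum_congr rfl fun i _ => Finset.sum_congr rfl fun j _ => ?_
  simp; ring

lemma sqrt_quad_smul {d : ℕ} (A : Matrix (Fin d) (Fin d) ℝ) {s : ℝ} (hs : 0 ≤ s) (x : Euc d) :
    √(quadForm A (s • x)) = s * √(quadForm A x) := by
  rw [quadForm_smul, Real.sqrt_mul (sq_nonneg s), Real.sqrt_sq hs]

lemma sqrt_quad_le {d : ℕ} {lmin lmax : ℝ} (hlm : 0 < lmax) {A : Matrix (Fin d) (Fin d) ℝ}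
    (hA : A ∈ matSet d lmin lmax) (x : Euc d) : √(quadForm A x) ≤ √lmax * ‖x‖ := by
  rw [← Real.sqrt_sq (norm_nonneg x), ← Real.sqrt_mul hlm.le]
  exact Real.sqrt_le_sqrt (hA.2 x).2

lemma scale_one {d : ℕ} {R lmin lmax : ℝ} (hR : 0 < R) (hl : 0 < lmin) (hlm : 0 < lmax) {A B : Matrix (Fin d) (Fin d) ℝ}
    (hA : A ∈ matSet d lmin lmax) (hB : B ∈ matSet d lmin lmax)
    (P P' : Measure (Euc d)) [IsProbabilityMeasure P] [IsProbabilityMeasure P']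
    (hP : P (closedBall 0 R)ᶜ = 0) (u : Euc d) (hu : ‖u‖ = 1)
    (hab : √(quadForm A u) ≤ √(quadForm B u)) :
    (√(quadForm B u) - √(quadForm A u))^2 ≤
      4 * exp 1 * (R^2 + (√lmax)^2) * ∫ x, |cauchyMix P A x - cauchyMix P' B x| := by
  refine real_key hR (Real.sqrt_pos.2 hlm) (Real.sqrt_nonneg _) hab
    (by simpa [hu] using sqrt_quad_le hlm hB u) fun s hs => ?_
  have h1 := char_diff hl hA hB P P' (s • u)
  rw [sqrt_quad_smul A hs, sqrt_quad_smul B hs] at h1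
  have h2 := charFun_lower P hP (s • u)
  rw [norm_smul, hu, mul_one, Real.norm_of_nonneg hs] at h2
  have h3 := norm_charFun_le_one (μ := P') (s • u)
  have h4 := norm_sub_norm_le (charFun P (s•u) * (Real.exp (-(s*√(quadForm A u))) : ℂ)) (charFun P' (s•u) * (Real.exp (-(s*√(quadForm B u))) : ℂ))
  rw [norm_mul, norm_mul, Complex.norm_real, Complex.norm_real, Real.norm_of_nonneg (exp_pos _).le, Real.norm_of_nonneg (exp_pos _).le] at h4
  have h5 := mul_le_mul_of_nonneg_right h2 (exp_pos (-(s*√(quadForm A u)))).le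
  have h6 := mul_le_mul_of_nonneg_right h3 (exp_pos (-(s*√(quadForm B u)))).le
  linarith

lemma scale_diff {d : ℕ} {R lmin lmax : ℝ} (hR : 0 < R) (hl : 0 < lmin) (hlm : 0 < lmax) {A B : Matrix (Fin d) (Fin d) ℝ}
    (hA : A ∈ matSet d lmin lmax) (hB : B ∈ matSet d lmin lmax)
    (P P' : Measure (Euc d)) [IsProbabilityMeasure P] [IsProbabilityMeasure P']
    (hP : P (closedBall 0 R)ᶜ = 0) (hP' : P' (closedBall 0 R)ᶜ = 0) (t : Euc d) :
    |√(quadForm A t) - √(quadForm B t)| ≤ ‖t‖ *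
      √(4 * exp 1 * (R^2 + (√lmax)^2) * ∫ x, |cauchyMix P A x - cauchyMix P' B x|) := by
  by_cases ht : t = 0
  · subst ht; simp [quadForm]
  have htn : 0 < ‖t‖ := norm_pos_iff.2 ht
  set u := ‖t‖⁻¹ • t with hu
  have hun : ‖u‖ = 1 := by rw [hu, norm_smul, norm_inv, norm_norm, inv_mul_cancel₀ htn.ne']
  have htu : t = ‖t‖ • u := by rw [hu, smul_smul, mul_inv_cancel₀ htn.ne', one_smul]
  have e1 : √(quadForm A t) = ‖t‖ * √(quadForm A u) := by
    conv_lhs => rw [htu]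
    exact sqrt_quad_smul A htn.le u
  have e2 : √(quadForm B t) = ‖t‖ * √(quadForm B u) := by
    conv_lhs => rw [htu]
    exact sqrt_quad_smul B htn.le u
  rw [e1, e2, ← mul_sub, abs_mul, abs_norm]
  gcongr
  apply Real.abs_le_sqrt
  rcases le_total (√(quadForm A u)) (√(quadForm B u)) with h | h
  · have := scale_one hR hl hlm hA hB P P' hP u hun h
    rwa [sub_sq_comm] at this
  · have := scale_one hR hl hlm hB hA P' P hP' u hun h
    simpa only [abs_sub_comm] using this

lemma op_bound {d : ℕ} {lmin lmax : ℝ} (hl : 0 < lmin) (hlm : 0 < lmax) {A B : Matrix (Fin d) (Fin d) ℝ}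
    (hA : A ∈ matSet d lmin lmax) (hB : B ∈ matSet d lmin lmax) {q : ℝ} (hq : 0 ≤ q)
    (h : ∀ t : Euc d, |√(quadForm A t) - √(quadForm B t)| ≤ ‖t‖ * q) :
    opNorm (A - B) ≤ 2 * √lmax * q := by
  have hsym : (A - B).IsSymm := hA.1.sub hB.1
  set T := LinearMap.toContinuousLinearMap (Matrix.toEuclideanLin (A - B)) with hT
  have hTs : (T : Euc d →ₗ[ℝ] Euc d).IsSymmetric := by
    have : (Matrix.toEuclideanLin (A - B)).IsSymmetric := by
      rw [Matrix.isSymmetric_toEuclideanLin_iff]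
      rw [Matrix.IsHermitian, Matrix.conjTranspose_eq_transpose_of_trivial]
      exact hsym
    exact this
  have hquad : ∀ x : Euc d, |quadForm (A - B) x| ≤ 2 * √lmax * q * ‖x‖^2 := by
    intro x
    have e : quadForm (A - B) x = quadForm A x - quadForm B x := by
      simp only [quadForm, ← Finset.sum_sub_distrib]
      refine Finset.sum_congr rfl fun i _ => Finset.sum_congr rfl fun j _ => ?_
      simp; ring
    have hA0 : 0 ≤ quadForm A x := le_trans (by positivity) (hA.2 x).1
    have hB0 : 0 ≤ quadForm B x := le_trans (by positivity) (hB.2 x).1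
    have e2 : quadForm A x - quadForm B x = (√(quadForm A x) - √(quadForm B x)) * (√(quadForm A x) + √(quadForm B x)) := by
      nlinarith [Real.sq_sqrt hA0, Real.sq_sqrt hB0]
    have h1 := sqrt_quad_le hlm hA x
    have h2 := sqrt_quad_le hlm hB x
    have h0 : 0 ≤ √(quadForm A x) + √(quadForm B x) := by positivity
    rw [e, e2, abs_mul, abs_of_nonneg h0]
    calc _ ≤ (‖x‖ * q) * (√lmax * ‖x‖ + √lmax * ‖x‖) := by gcongr; exact h x
      _ = _ := by ring
  change ‖T‖ ≤ _
  rw [ContinuousLinearMap.norm_eq_iSup_rayleighQuotient T hTs]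
  refine ciSup_le fun x => ?_
  rw [ContinuousLinearMap.rayleighQuotient, ContinuousLinearMap.reApplyInnerSelf_apply]
  have e3 : inner ℝ (T x) x = quadForm (A - B) x := by
    rw [quadForm_inner, real_inner_comm]; rfl
  simp only [RCLike.re_to_real]
  rw [e3, abs_div, abs_of_nonneg (sq_nonneg ‖x‖)]
  by_cases hx : x = 0
  · subst hx; simp; positivity
  · rw [div_le_iff₀ (by have := norm_pos_iff.2 hx; positivity)]
    exact hquad x

lemma charFun_diff {d : ℕ} {R lmin lmax : ℝ} (hR : 0 < R) (hl : 0 < lmin) (hlm : 0 < lmax) {A B : Matrix (Fin d) (Fin d) ℝ}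
    (hA : A ∈ matSet d lmin lmax) (hB : B ∈ matSet d lmin lmax)
    (P P' : Measure (Euc d)) [IsProbabilityMeasure P] [IsProbabilityMeasure P']
    (hP : P (closedBall 0 R)ᶜ = 0) (hP' : P' (closedBall 0 R)ᶜ = 0) (t : Euc d) :
    ‖charFun P t - charFun P' t‖ ≤ (2 + √(4 * exp 1 * (R^2 + (√lmax)^2))) *
      √(∫ x, |cauchyMix P A x - cauchyMix P' B x|) * exp ((√lmax + 1) * ‖t‖) := by
  have h1 := char_diff hl hA hB P P' t
  have h2 := scale_diff hR hl hlm hA hB P P' hP hP' t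
  set e := ∫ x, |cauchyMix P A x - cauchyMix P' B x| with he
  have he0 : 0 ≤ e := integral_nonneg fun x => abs_nonneg _
  set k := 4 * exp 1 * (R^2 + (√lmax)^2) with hk
  have hk0 : 0 ≤ k := by positivity
  rw [Real.sqrt_mul hk0] at h2
  have ha := sqrt_quad_le hlm hA t
  set a := √(quadForm A t) with hadef
  set b := √(quadForm B t) with hbdef
  have ha0 : 0 ≤ a := Real.sqrt_nonneg _
  have hb0 : 0 ≤ b := Real.sqrt_nonneg _
  have hp := norm_charFun_le_one (μ := P) t
  have hp' := norm_charFun_le_one (μ := P') t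
  have hL0 : 0 ≤ √lmax := Real.sqrt_nonneg _
  have hexp1 : 1 ≤ exp ((√lmax + 1) * ‖t‖) := Real.one_le_exp (by positivity)
  rcases le_total 1 e with h | h
  · have hse : 1 ≤ √e := Real.one_le_sqrt.2 h
    calc ‖charFun P t - charFun P' t‖ ≤ 2 := by
          have := norm_sub_le (charFun P t) (charFun P' t); linarith
      _ = 2 * 1 * 1 := by ring
      _ ≤ _ := by
        gcongr
        have := Real.sqrt_nonneg k
        linarith
  · have hse : e ≤ √e := by
      have h3 : √e ≤ 1 := Real.sqrt_le_one.2 h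
      nlinarith [Real.sq_sqrt he0, Real.sqrt_nonneg e]
    have hlip : |exp (-b) - exp (-a)| ≤ |a - b| := by
      rcases le_total a b with hab | hab
      · have h4 : exp (-b) ≤ exp (-a) := exp_le_exp.2 (by linarith)
        have h5 := add_one_le_exp (a - b)
        have h6 : exp (-a) ≤ 1 := exp_le_one_iff.2 (by linarith)
        have h7 : exp (-b) = exp (-a) * exp (a - b) := by rw [← exp_add]; congr 1; ring
        rw [abs_of_nonpos (by linarith), abs_of_nonpos (by linarith), h7]
        nlinarith [exp_pos (-a)]
      · have h4 : exp (-a) ≤ exp (-b) := exp_le_exp.2 (by linarith)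
        have h5 := add_one_le_exp (b - a)
        have h6 : exp (-b) ≤ 1 := exp_le_one_iff.2 (by linarith)
        have h7 : exp (-a) = exp (-b) * exp (b - a) := by rw [← exp_add]; congr 1; ring
        rw [abs_of_nonneg (by linarith), abs_of_nonneg (by linarith), h7]
        nlinarith [exp_pos (-b)]
    have hid : charFun P t - charFun P' t = (exp a : ℂ) * ((charFun P t * (exp (-a) : ℂ) - charFun P' t * (exp (-b) : ℂ))
        + charFun P' t * ((exp (-b) - exp (-a) : ℝ) : ℂ)) := by
      have h8 : (exp a : ℂ) * (exp (-a) : ℂ) = 1 := by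
        rw [← Complex.ofReal_mul, ← Real.exp_add]; simp
      rw [Complex.ofReal_sub]
      linear_combination (charFun P' t - charFun P t) * h8
    rw [hid, norm_mul, Complex.norm_real, Real.norm_of_nonneg (exp_pos _).le]
    have h9 : ‖charFun P' t * ((exp (-b) - exp (-a) : ℝ) : ℂ)‖ ≤ ‖t‖ * (√k * √e) := by
      rw [norm_mul, Complex.norm_real, Real.norm_eq_abs]
      calc _ ≤ 1 * |a - b| := by gcongr
        _ ≤ _ := by linarith
    have h10 : ‖t‖ ≤ exp ‖t‖ := by have := add_one_le_exp ‖t‖; linarith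
    have h11 : 1 ≤ exp ‖t‖ := Real.one_le_exp (norm_nonneg _)
    have hsk := Real.sqrt_nonneg k
    have hs0 := Real.sqrt_nonneg e
    calc _ ≤ exp (√lmax * ‖t‖) * (e + ‖t‖ * (√k * √e)) := by
          gcongr
          exact (norm_add_le _ _).trans (add_le_add h1 h9)
      _ ≤ exp (√lmax * ‖t‖) * (2 * √e * exp ‖t‖ + exp ‖t‖ * (√k * √e)) := by
          gcongr
          nlinarith
      _ = _ := by
          rw [add_mul (√lmax) 1, one_mul, exp_add]; ring

/-- Theorem 4.3 (inverse bound for homoscedastic Cauchy location-scale mixtures). -/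
theorem cauchy_inverse_bound
    (d : ℕ) (hd : 1 ≤ d) (R lmin lmax : ℝ) (hR : 0 < R) (hlmin : 0 < lmin) (hl : lmin < lmax) :
    ∃ C C' : ℝ, 0 < C ∧ 0 < C' ∧
      ∀ (P P' : Measure (Euc d)), IsProbabilityMeasure P → IsProbabilityMeasure P' →
        P (closedBall 0 R)ᶜ = 0 → P' (closedBall 0 R)ᶜ = 0 →
        ∀ A ∈ matSet d lmin lmax, ∀ B ∈ matSet d lmin lmax,
          C' * ((if 0 < W1 P P' then Real.exp (-(C / W1 P P')) else 0) +
                opNorm (A - B) ^ 2) ≤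
          ∫ x, |cauchyMix P A x - cauchyMix P' B x| := by
  have hlm : 0 < lmax := hlmin.trans hl
  obtain ⟨C1, C2, hC1, hC2, hsm⟩ := smoothing d R hR
  have hL : 0 < √lmax := Real.sqrt_pos.2 hlm
  set L := √lmax with hLdef
  obtain ⟨k, hk⟩ : ∃ k, k = 4 * exp 1 * (R^2 + L^2) := ⟨_, rfl⟩
  have hk0 : 0 < k := by rw [hk]; positivity
  obtain ⟨C4, hC4⟩ : ∃ C4, C4 = C2 * d.factorial * (2 + √k) := ⟨_, rfl⟩
  have hC40 : 0 < C4 := by rw [hC4]; positivity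
  refine ⟨4 * (L+2) * C1 + 2, 1 / ((2*C4)^2 + 4*L^2*k), by positivity, by positivity, ?_⟩
  intro P P' hPp hPp' hP hP' A hA B hB
  have hcd := charFun_diff hR hlmin hlm hA hB P P' hP hP'
  have hsd := scale_diff hR hlmin hlm hA hB P P' hP hP'
  rw [← hLdef, ← hk] at hcd hsd
  set e := ∫ x, |cauchyMix P A x - cauchyMix P' B x| with he
  have he0 : 0 ≤ e := integral_nonneg fun x => abs_nonneg _
  have hop := op_bound hlmin hlm hA hB (Real.sqrt_nonneg _) hsd
  have hop2 : opNorm (A - B)^2 ≤ 4*L^2*k*e := by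
    have h0 : 0 ≤ opNorm (A - B) := norm_nonneg _
    calc opNorm (A - B)^2 ≤ (2*L*√(k*e))^2 := by gcongr
      _ = 4*L^2*(√(k*e))^2 := by ring
      _ = _ := by rw [Real.sq_sqrt (mul_nonneg hk0.le he0)]; ring
  have hW : (if 0 < W1 P P' then Real.exp (-((4 * (L+2) * C1 + 2) / W1 P P')) else 0) ≤ (2*C4)^2 * e := by
    split_ifs with hw
    · set w := W1 P P' with hwdef
      have hT : 0 < 2*C1/w := by positivity
      set T := 2*C1/w with hTdef
      have h1 := hsm P P' hPp hPp' hP hP' T ((2 + √k) * √e * exp ((L+1)*T)) hT (by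
        intro t ht
        refine (hcd t).trans ?_
        gcongr)
      rw [← hwdef] at h1
      have h2 : C1 / T = w/2 := by rw [hTdef]; field_simp
      have h3 : T^d ≤ d.factorial * exp T := by
        have := Real.pow_div_factorial_le_exp T hT.le d
        rw [div_le_iff₀ (by positivity)] at this
        linarith
      have h4 : C2 * T^d * ((2 + √k) * √e * exp ((L+1)*T)) ≤ C4 * √e * exp ((L+2)*T) := by
        calc _ ≤ C2 * (d.factorial * exp T) * ((2 + √k) * √e * exp ((L+1)*T)) := by gcongr
          _ = C4 * √e * (exp T * exp ((L+1)*T)) := by rw [hC4]; ring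
          _ = _ := by rw [← exp_add]; congr 2; ring
      have h5 : exp (-(1/w)) ≤ w := by
        rw [exp_neg]
        have := add_one_le_exp (1/w)
        calc (exp (1/w))⁻¹ ≤ (1/w)⁻¹ := by gcongr; linarith
          _ = w := by simp
      have h6 : exp (-(1/w)) ≤ 2*C4 * √e * exp ((L+2)*T) := by linarith
      have h7 : exp (-(1/w)) * exp (-((L+2)*T)) ≤ 2*C4*√e := by
        calc _ ≤ 2*C4 * √e * exp ((L+2)*T) * exp (-((L+2)*T)) := by gcongr
          _ = _ := by rw [mul_assoc, ← exp_add]; simp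
      calc exp (-((4 * (L+2) * C1 + 2) / w)) = (exp (-(1/w)) * exp (-((L+2)*T)))^2 := by
            rw [← exp_add, ← exp_nat_mul]; congr 1; rw [hTdef]; push_cast; field_simp; ring
        _ ≤ (2*C4*√e)^2 := by gcongr
        _ = _ := by rw [mul_pow, Real.sq_sqrt he0]
    · positivity
  rw [one_div, inv_mul_le_iff₀ (by positivity)]
  linarith
end
end
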